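/- arXiv:2410.05552 — 6 statements merged into one kernel-verified Lean document; each statement's English description precedes it below -/
import Mathlib

section
/- Under the sequential experiment without covariates, the intermediary estimator satisfies E[(τ̂₂ − τ)²] − E[(τ̂* − τ)²] = (1/n²) · E[ Σ_{i=1}^n (σ⁽¹⁾)²/e_i + Σ_{i=1}^n (σ⁽⁰⁾)²/(1 − e_i) − n·( (σ⁽¹⁾)²/e* + (σ⁽⁰⁾)²/(1 − e*) ) ], where e* = σ⁽¹⁾/(σ⁽¹⁾ + σ⁽⁰⁾). -/
open MeasureTheory ProbabilityTheory
open scoped ENNReal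

namespace AdaptiveExperiment

/-- The intermediary estimator `τ̂₂` of the average treatment effect `τ = μ1 - μ0`,
built from the collected data `(Wᵢ, Yᵢ)` and the propensity scores `eᵢ`. -/
noncomputable def tauHat2 {Ω : Type*} (n : ℕ) (μ1 μ0 : ℝ)
    (W Y e : Fin n → Ω → ℝ) (ω : Ω) : ℝ :=
  (μ1 - μ0) + (1 / (n : ℝ)) * ∑ i : Fin n,
    ((Y i ω - μ1) * W i ω / e i ω - (Y i ω - μ0) * (1 - W i ω) / (1 - e i ω))

/-- A sequential (possibly adaptive) experiment without covariates, with `n` units,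
arm means `μ1, μ0`, arm standard deviations `σ1, σ0 > 0`, filtration `F`
(`F k` is the σ-algebra generated by the data of the first `k` units),
treatment indicators `W`, outcomes `Y`, and propensity scores `e`. -/
structure IsSeqExp {Ω : Type*} [m0 : MeasurableSpace Ω] (P : Measure Ω) (n : ℕ)
    (μ1 μ0 σ1 σ0 : ℝ) (F : ℕ → MeasurableSpace Ω)
    (W Y e : Fin n → Ω → ℝ) : Prop where
  isProb : IsProbabilityMeasure P
  sigma1_pos : 0 < σ1
  sigma0_pos : 0 < σ0
  F_mono : Monotone F
  F_le : ∀ k, F k ≤ m0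
  /-- treatments are binary (coded as real numbers `0` and `1`) -/
  W_bool : ∀ i ω, W i ω = 0 ∨ W i ω = 1
  /-- propensity scores take values in `(0,1)` -/
  e_mem : ∀ i ω, e i ω ∈ Set.Ioo (0 : ℝ) 1
  /-- `eᵢ` is `𝓕_{i-1}`-measurable -/
  e_meas : ∀ i : Fin n, Measurable[F i.val] (e i)
  /-- the data of unit `i` is `𝓕ᵢ`-measurable -/
  W_meas : ∀ i : Fin n, Measurable[F (i.val + 1)] (W i)
  Y_meas : ∀ i : Fin n, Measurable[F (i.val + 1)] (Y i)
  /-- `P(Wᵢ = 1 | 𝓕_{i-1}) = eᵢ` -/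
  W_condexp : ∀ i : Fin n, P[W i|F i.val] =ᵐ[P] e i
  /-- conditionally on `𝓕_{i-1}` and `Wᵢ`, the outcome `Yᵢ` has mean `μ^{(Wᵢ)}` -/
  Y_mean : ∀ i : Fin n,
    P[Y i|F i.val ⊔ MeasurableSpace.comap (W i) (inferInstance : MeasurableSpace ℝ)]
      =ᵐ[P] fun ω => μ1 * W i ω + μ0 * (1 - W i ω)
  /-- conditionally on `𝓕_{i-1}` and `Wᵢ`, the outcome `Yᵢ` has variance `(σ^{(Wᵢ)})²` -/
  Y_var : ∀ i : Fin n,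
    P[(fun ω => (Y i ω - (μ1 * W i ω + μ0 * (1 - W i ω))) ^ 2)|
        F i.val ⊔ MeasurableSpace.comap (W i) (inferInstance : MeasurableSpace ℝ)]
      =ᵐ[P] fun ω => σ1 ^ 2 * W i ω + σ0 ^ 2 * (1 - W i ω)
  /-- integrability of all the squares appearing in the analysis -/
  int_Y_sq : ∀ i : Fin n, Integrable (fun ω => (Y i ω) ^ 2) P
  int_term_sq : ∀ i : Fin n, Integrable
    (fun ω => ((Y i ω - μ1) * W i ω / e i ω
      - (Y i ω - μ0) * (1 - W i ω) / (1 - e i ω)) ^ 2) P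
  int_inv_e_sq : ∀ i : Fin n, Integrable (fun ω => 1 / e i ω ^ 2) P
  int_inv_one_sub_e_sq : ∀ i : Fin n, Integrable (fun ω => 1 / (1 - e i ω) ^ 2) P

/-- Integrated pull-out property: a factor with conditional expectation `h` given `m` may be
replaced by `h` when integrated against an `m`-measurable factor. -/
theorem integral_mul_eq_of_condExp_ae_eq {Ω : Type*} {m m0 : MeasurableSpace Ω} {P : Measure Ω}
    [IsFiniteMeasure P] (hm : m ≤ m0) {f g h : Ω → ℝ} (hf : Measurable[m] f)
    (hg : Integrable g P) (hfg : Integrable (fun ω => f ω * g ω) P) (hh : P[g|m] =ᵐ[P] h) :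
    ∫ ω, f ω * g ω ∂P = ∫ ω, f ω * h ω ∂P := by
  have key : P[f * g|m] =ᵐ[P] f * P[g|m] :=
    condExp_mul_of_stronglyMeasurable_left hf.stronglyMeasurable hfg hg
  calc ∫ ω, f ω * g ω ∂P = ∫ ω, (P[f * g|m]) ω ∂P := (integral_condExp hm).symm
    _ = ∫ ω, f ω * h ω ∂P := by
      refine integral_congr_ae ?_
      filter_upwards [key, hh] with ω h1 h2
      rw [h1, Pi.mul_apply, h2]

namespace IsSeqExp

theorem measurable_W_sup_comap {Ω : Type*} {n : ℕ} {F : ℕ → MeasurableSpace Ω}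
    {W : Fin n → Ω → ℝ} (i : Fin n) :
    Measurable[F i.val ⊔ MeasurableSpace.comap (W i) (inferInstance : MeasurableSpace ℝ)]
      (W i) :=
  (comap_measurable (W i)).mono le_sup_right le_rfl

variable {Ω : Type*} [m0 : MeasurableSpace Ω] {P : Measure Ω} {n : ℕ} {μ1 μ0 σ1 σ0 : ℝ}
  {F : ℕ → MeasurableSpace Ω} {W Y e : Fin n → Ω → ℝ}

theorem sup_comap_le (h : IsSeqExp P n μ1 μ0 σ1 σ0 F W Y e) (i : Fin n) :
    F i.val ⊔ MeasurableSpace.comap (W i) (inferInstance : MeasurableSpace ℝ) ≤ m0 :=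
  sup_le (h.F_le _) ((h.W_meas i).comap_le.trans (h.F_le _))

theorem measurable_weight (h : IsSeqExp P n μ1 μ0 σ1 σ0 F W Y e) (i : Fin n) :
    Measurable[F i.val ⊔ MeasurableSpace.comap (W i) (inferInstance : MeasurableSpace ℝ)]
      (fun ω => W i ω / e i ω - (1 - W i ω) / (1 - e i ω)) := by
  have hW := measurable_W_sup_comap (F := F) (W := W) i
  have he := (h.e_meas i).mono
    (le_sup_left (b := MeasurableSpace.comap (W i) (inferInstance : MeasurableSpace ℝ))) le_rfl
  exact (hW.div he).sub ((measurable_const.sub hW).div (measurable_const.sub he))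

theorem term_eq (h : IsSeqExp P n μ1 μ0 σ1 σ0 F W Y e) (i : Fin n) (ω : Ω) :
    (Y i ω - μ1) * W i ω / e i ω - (Y i ω - μ0) * (1 - W i ω) / (1 - e i ω)
      = (W i ω / e i ω - (1 - W i ω) / (1 - e i ω))
        * (Y i ω - (μ1 * W i ω + μ0 * (1 - W i ω))) := by
  rcases h.W_bool i ω with hw | hw <;> rw [hw] <;> ring

theorem measurable_term (h : IsSeqExp P n μ1 μ0 σ1 σ0 F W Y e) (i : Fin n) :
    Measurable[F (i.val + 1)] (fun ω =>
      (Y i ω - μ1) * W i ω / e i ω - (Y i ω - μ0) * (1 - W i ω) / (1 - e i ω)) := by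
  have hW := h.W_meas i
  have hY := h.Y_meas i
  have he := (h.e_meas i).mono (h.F_mono i.val.le_succ) le_rfl
  exact (((hY.sub measurable_const).mul hW).div he).sub
    (((hY.sub measurable_const).mul (measurable_const.sub hW)).div (measurable_const.sub he))

theorem memLp_term (h : IsSeqExp P n μ1 μ0 σ1 σ0 F W Y e) (i : Fin n) :
    MemLp (fun ω =>
      (Y i ω - μ1) * W i ω / e i ω - (Y i ω - μ0) * (1 - W i ω) / (1 - e i ω)) 2 P :=
  (memLp_two_iff_integrable_sq
    ((h.measurable_term i).mono (h.F_le _) le_rfl).aestronglyMeasurable).2 (h.int_term_sq i)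

theorem memLp_W (h : IsSeqExp P n μ1 μ0 σ1 σ0 F W Y e) (i : Fin n) : MemLp (W i) 2 P := by
  have := h.isProb
  refine MemLp.of_bound ((h.W_meas i).mono (h.F_le _) le_rfl).aestronglyMeasurable 1
    (ae_of_all _ fun ω => ?_)
  rcases h.W_bool i ω with hw | hw <;> simp [hw]

theorem memLp_residual (h : IsSeqExp P n μ1 μ0 σ1 σ0 F W Y e) (i : Fin n) :
    MemLp (fun ω => Y i ω - (μ1 * W i ω + μ0 * (1 - W i ω))) 2 P := by
  have := h.isProb
  have hY : MemLp (Y i) 2 P := (memLp_two_iff_integrable_sq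
    ((h.Y_meas i).mono (h.F_le _) le_rfl).aestronglyMeasurable).2 (h.int_Y_sq i)
  have hW := h.memLp_W i
  exact hY.sub ((hW.const_mul μ1).add (((memLp_const 1).sub hW).const_mul μ0))

theorem condExp_residual (h : IsSeqExp P n μ1 μ0 σ1 σ0 F W Y e) (i : Fin n) :
    P[(fun ω => Y i ω - (μ1 * W i ω + μ0 * (1 - W i ω)))|
        F i.val ⊔ MeasurableSpace.comap (W i) (inferInstance : MeasurableSpace ℝ)]
      =ᵐ[P] fun _ => 0 := by
  have := h.isProb
  have hM : Integrable (fun ω => μ1 * W i ω + μ0 * (1 - W i ω)) P :=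
    integrable_condExp.congr (h.Y_mean i)
  have hY : Integrable (Y i) P :=
    (((h.memLp_residual i).integrable one_le_two).add hM).congr
      (ae_of_all _ fun ω => by simp)
  have hW := measurable_W_sup_comap (F := F) (W := W) i
  have hMm :
      Measurable[F i.val ⊔ MeasurableSpace.comap (W i) (inferInstance : MeasurableSpace ℝ)]
        (fun ω => μ1 * W i ω + μ0 * (1 - W i ω)) :=
    (measurable_const.mul hW).add (measurable_const.mul (measurable_const.sub hW))
  have hMc := condExp_of_stronglyMeasurable (h.sup_comap_le i) hMm.stronglyMeasurable hM
  filter_upwards [condExp_sub hY hM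
    (F i.val ⊔ MeasurableSpace.comap (W i) (inferInstance : MeasurableSpace ℝ)), h.Y_mean i]
    with ω h1 h2
  refine h1.trans ?_
  rw [Pi.sub_apply, h2, hMc, sub_self]

theorem integral_term_mul_term_of_lt (h : IsSeqExp P n μ1 μ0 σ1 σ0 F W Y e) {i j : Fin n}
    (hij : i < j) :
    ∫ ω, ((Y i ω - μ1) * W i ω / e i ω - (Y i ω - μ0) * (1 - W i ω) / (1 - e i ω))
      * ((Y j ω - μ1) * W j ω / e j ω - (Y j ω - μ0) * (1 - W j ω) / (1 - e j ω)) ∂P = 0 := by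
  have := h.isProb
  have hXi := (h.measurable_term i).mono ((h.F_mono (Nat.succ_le_of_lt hij)).trans
    (le_sup_left (b := MeasurableSpace.comap (W j) (inferInstance : MeasurableSpace ℝ)))) le_rfl
  have hint := (h.memLp_term i).integrable_mul (h.memLp_term j)
  have heq : ∀ ω,
      ((Y i ω - μ1) * W i ω / e i ω - (Y i ω - μ0) * (1 - W i ω) / (1 - e i ω))
        * ((Y j ω - μ1) * W j ω / e j ω - (Y j ω - μ0) * (1 - W j ω) / (1 - e j ω))
      = (((Y i ω - μ1) * W i ω / e i ω - (Y i ω - μ0) * (1 - W i ω) / (1 - e i ω))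
          * (W j ω / e j ω - (1 - W j ω) / (1 - e j ω)))
        * (Y j ω - (μ1 * W j ω + μ0 * (1 - W j ω))) := fun ω => by
    rw [h.term_eq j, mul_assoc]
  rw [integral_congr_ae (ae_of_all _ heq), integral_mul_eq_of_condExp_ae_eq (h.sup_comap_le j)
    (f := fun ω => ((Y i ω - μ1) * W i ω / e i ω - (Y i ω - μ0) * (1 - W i ω) / (1 - e i ω))
      * (W j ω / e j ω - (1 - W j ω) / (1 - e j ω)))
    (hXi.mul (h.measurable_weight j)) ((h.memLp_residual j).integrable one_le_two)
    (hint.congr (ae_of_all _ heq)) (h.condExp_residual j)]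
  simp

theorem integrable_div_e (h : IsSeqExp P n μ1 μ0 σ1 σ0 F W Y e) (c : ℝ) (i : Fin n) :
    Integrable (fun ω => c / e i ω) P := by
  have he := (h.e_meas i).mono (h.F_le _) le_rfl
  refine ((h.int_inv_e_sq i).const_mul |c|).mono' (measurable_const.div he).aestronglyMeasurable
    (ae_of_all _ fun ω => ?_)
  obtain ⟨h0, h1⟩ := h.e_mem i ω
  rw [Real.norm_eq_abs, abs_div, abs_of_pos h0, mul_one_div]
  gcongr
  nlinarith

theorem integrable_div_one_sub_e (h : IsSeqExp P n μ1 μ0 σ1 σ0 F W Y e) (c : ℝ) (i : Fin n) :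
    Integrable (fun ω => c / (1 - e i ω)) P := by
  have he := (h.e_meas i).mono (h.F_le _) le_rfl
  refine ((h.int_inv_one_sub_e_sq i).const_mul |c|).mono'
    (measurable_const.div (measurable_const.sub he)).aestronglyMeasurable
    (ae_of_all _ fun ω => ?_)
  obtain ⟨h0, h1⟩ := h.e_mem i ω
  have h2 : 0 < 1 - e i ω := sub_pos.2 h1
  rw [Real.norm_eq_abs, abs_div, abs_of_pos h2, mul_one_div]
  gcongr
  nlinarith

theorem integral_term_sq (h : IsSeqExp P n μ1 μ0 σ1 σ0 F W Y e) (i : Fin n) :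
    ∫ ω, ((Y i ω - μ1) * W i ω / e i ω
      - (Y i ω - μ0) * (1 - W i ω) / (1 - e i ω)) ^ 2 ∂P
      = ∫ ω, (σ1 ^ 2 / e i ω + σ0 ^ 2 / (1 - e i ω)) ∂P := by
  have := h.isProb
  have heq : ∀ ω, ((Y i ω - μ1) * W i ω / e i ω
      - (Y i ω - μ0) * (1 - W i ω) / (1 - e i ω)) ^ 2
      = (W i ω / e i ω - (1 - W i ω) / (1 - e i ω)) ^ 2
        * (Y i ω - (μ1 * W i ω + μ0 * (1 - W i ω))) ^ 2 := fun ω => by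
    rw [h.term_eq i, mul_pow]
  have hsplit : ∀ ω, (W i ω / e i ω - (1 - W i ω) / (1 - e i ω)) ^ 2
        * (σ1 ^ 2 * W i ω + σ0 ^ 2 * (1 - W i ω))
      = σ1 ^ 2 * (1 / e i ω ^ 2) * W i ω
        + σ0 ^ 2 * (1 / (1 - e i ω) ^ 2) * (1 - W i ω) := fun ω => by
    generalize 1 - e i ω = x
    rcases h.W_bool i ω with hw | hw <;> rw [hw] <;> ring
  have hWm := (h.W_meas i).mono (h.F_le _) le_rfl
  have hW : Integrable (W i) P := (h.memLp_W i).integrable one_le_two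
  have hW' : Integrable (fun ω => 1 - W i ω) P := (integrable_const 1).sub hW
  have hWc : P[(fun ω => 1 - W i ω)|F i.val] =ᵐ[P] fun ω => 1 - e i ω := by
    filter_upwards [condExp_sub (integrable_const (1 : ℝ)) hW (F i.val), h.W_condexp i]
      with ω h1 h2
    refine h1.trans ?_
    rw [Pi.sub_apply, h2, condExp_const (h.F_le _)]
  have i1 : Integrable (fun ω => σ1 ^ 2 * (1 / e i ω ^ 2) * W i ω) P := by
    refine ((h.int_inv_e_sq i).const_mul (σ1 ^ 2)).mul_bdd (c := 1)
      hWm.aestronglyMeasurable (ae_of_all _ fun ω => ?_)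
    rcases h.W_bool i ω with hw | hw <;> simp [hw]
  have i0 : Integrable (fun ω => σ0 ^ 2 * (1 / (1 - e i ω) ^ 2) * (1 - W i ω)) P := by
    refine ((h.int_inv_one_sub_e_sq i).const_mul (σ0 ^ 2)).mul_bdd (c := 1)
      (measurable_const.sub hWm).aestronglyMeasurable (ae_of_all _ fun ω => ?_)
    rcases h.W_bool i ω with hw | hw <;> simp [hw]
  rw [integral_congr_ae (ae_of_all _ heq), integral_mul_eq_of_condExp_ae_eq (h.sup_comap_le i)
    (f := fun ω => (W i ω / e i ω - (1 - W i ω) / (1 - e i ω)) ^ 2)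
    ((h.measurable_weight i).pow_const 2) (h.memLp_residual i).integrable_sq
    ((h.int_term_sq i).congr (ae_of_all _ heq)) (h.Y_var i),
    integral_congr_ae (ae_of_all _ hsplit), integral_add i1 i0,
    integral_mul_eq_of_condExp_ae_eq (h.F_le i.val) (f := fun ω => σ1 ^ 2 * (1 / e i ω ^ 2))
      (measurable_const.mul (measurable_const.div ((h.e_meas i).pow_const 2)))
      hW i1 (h.W_condexp i),
    integral_mul_eq_of_condExp_ae_eq (h.F_le i.val)
      (f := fun ω => σ0 ^ 2 * (1 / (1 - e i ω) ^ 2))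
      (measurable_const.mul (measurable_const.div
        ((measurable_const.sub (h.e_meas i)).pow_const 2)))
      hW' i0 hWc,
    integral_add (h.integrable_div_e _ i) (h.integrable_div_one_sub_e _ i)]
  congr 1 <;> refine integral_congr_ae (ae_of_all _ fun ω => ?_)
  · have h0 : e i ω ≠ 0 := (h.e_mem i ω).1.ne'
    field_simp
  · have h0 : 1 - e i ω ≠ 0 := (sub_pos.2 (h.e_mem i ω).2).ne'
    field_simp

/-- The mean squared error of the intermediary estimator. -/
theorem integral_tauHat2_sub_sq (h : IsSeqExp P n μ1 μ0 σ1 σ0 F W Y e) :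
    ∫ ω, (tauHat2 n μ1 μ0 W Y e ω - (μ1 - μ0)) ^ 2 ∂P
      = (1 / (n : ℝ) ^ 2) * ∫ ω,
        ((∑ i : Fin n, σ1 ^ 2 / e i ω) + ∑ i : Fin n, σ0 ^ 2 / (1 - e i ω)) ∂P := by
  have hsq : ∀ ω, (tauHat2 n μ1 μ0 W Y e ω - (μ1 - μ0)) ^ 2
      = (1 / (n : ℝ) ^ 2) * ∑ i : Fin n, ∑ j : Fin n,
        ((Y i ω - μ1) * W i ω / e i ω - (Y i ω - μ0) * (1 - W i ω) / (1 - e i ω))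
        * ((Y j ω - μ1) * W j ω / e j ω - (Y j ω - μ0) * (1 - W j ω) / (1 - e j ω)) :=
    fun ω => by
      rw [tauHat2, add_sub_cancel_left, mul_pow, one_div_pow, sq (∑ i : Fin n, _),
        Finset.sum_mul_sum]
  have hint : ∀ i j : Fin n, Integrable (fun ω =>
      ((Y i ω - μ1) * W i ω / e i ω - (Y i ω - μ0) * (1 - W i ω) / (1 - e i ω))
      * ((Y j ω - μ1) * W j ω / e j ω - (Y j ω - μ0) * (1 - W j ω) / (1 - e j ω))) P :=
    fun i j => (h.memLp_term i).integrable_mul (h.memLp_term j)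
  rw [integral_congr_ae (ae_of_all _ hsq), integral_const_mul,
    integral_finsetSum _ fun i _ => integrable_finsetSum _ fun j _ => hint i j]
  simp_rw [← Finset.sum_add_distrib]
  rw [integral_finsetSum (f := fun i ω => σ1 ^ 2 / e i ω + σ0 ^ 2 / (1 - e i ω)) _ fun i _ =>
    (h.integrable_div_e _ i).add (h.integrable_div_one_sub_e _ i)]
  congr 1
  refine Finset.sum_congr rfl fun i _ => ?_
  rw [integral_finsetSum _ fun j _ => hint i j, Finset.sum_eq_single i, ← h.integral_term_sq i]
  · simp_rw [← sq]
  · intro j _ hji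
    rcases lt_or_gt_of_ne hji with hlt | hlt
    · simpa only [mul_comm] using h.integral_term_mul_term_of_lt hlt
    · exact h.integral_term_mul_term_of_lt hlt
  · simp

end IsSeqExp

/-- Comparing the intermediary estimator `τ̂₂` of an arbitrary
(non-anticipating) sequential experiment with the idealized optimal estimator `τ̂*`
(the same estimator computed from data collected under the constant Neyman propensity
`e* = σ⁽¹⁾/(σ⁽¹⁾+σ⁽⁰⁾)`):
`E[(τ̂₂ − τ)²] − E[(τ̂* − τ)²]
  = (1/n²)·E[ Σᵢ (σ⁽¹⁾)²/eᵢ + Σᵢ (σ⁽⁰⁾)²/(1 − eᵢ) − n((σ⁽¹⁾)²/e* + (σ⁽⁰⁾)²/(1 − e*)) ]`. -/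
theorem statement_0 {Ω Ω' : Type*} [MeasurableSpace Ω] [MeasurableSpace Ω']
    (P : Measure Ω) (P' : Measure Ω')
    (n : ℕ) (hn : 1 ≤ n) (μ1 μ0 σ1 σ0 : ℝ)
    (F : ℕ → MeasurableSpace Ω) (W Y e : Fin n → Ω → ℝ)
    (F' : ℕ → MeasurableSpace Ω') (W' Y' e' : Fin n → Ω' → ℝ)
    (hExp : IsSeqExp P n μ1 μ0 σ1 σ0 F W Y e)
    (hExp' : IsSeqExp P' n μ1 μ0 σ1 σ0 F' W' Y' e')
    (hstar : ∀ i ω, e' i ω = σ1 / (σ1 + σ0)) :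
    ∫ ω, (tauHat2 n μ1 μ0 W Y e ω - (μ1 - μ0)) ^ 2 ∂P -
      ∫ ω, (tauHat2 n μ1 μ0 W' Y' e' ω - (μ1 - μ0)) ^ 2 ∂P' =
    (1 / (n : ℝ) ^ 2) * ∫ ω,
      ((∑ i : Fin n, σ1 ^ 2 / e i ω) + (∑ i : Fin n, σ0 ^ 2 / (1 - e i ω))
        - n * (σ1 ^ 2 / (σ1 / (σ1 + σ0)) + σ0 ^ 2 / (1 - σ1 / (σ1 + σ0)))) ∂P := by
  have := hExp.isProb
  have := hExp'.isProb
  have hint : Integrable (fun ω =>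
      (∑ i : Fin n, σ1 ^ 2 / e i ω) + ∑ i : Fin n, σ0 ^ 2 / (1 - e i ω)) P :=
    (integrable_finsetSum _ fun i _ => hExp.integrable_div_e _ i).add
      (integrable_finsetSum _ fun i _ => hExp.integrable_div_one_sub_e _ i)
  rw [hExp.integral_tauHat2_sub_sq, hExp'.integral_tauHat2_sub_sq, ← mul_sub,
    integral_sub hint (integrable_const _)]
  simp [hstar, mul_add]

end AdaptiveExperiment
end

section
/- Under batched incomplete randomization, for every batch k one has Σ_{i ∈ batch k} (1 − W_i/e_k) = 0 and Σ_{i ∈ batch k} (1 − (1 − W_i)/(1 − e_k)) = 0 almost surely; consequently, for any (possibly random) real numbers μ̂⁽¹⁾, μ̂⁽⁰⁾, the AIPW estimator τ̂₁ = μ̂⁽¹⁾ − μ̂⁽⁰⁾ + (1/n) Σ_{i=1}^n [ (Y_i − μ̂⁽¹⁾)W_i/e_i − (Y_i − μ̂⁽⁰⁾)(1 − W_i)/(1 − e_i) ] equals the intermediary estimator τ̂₂ almost surely, and the cross term satisfies E[(τ̂₁ − τ̂₂)(τ̂₂ − τ)] = 0. -/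
open MeasureTheory ProbabilityTheory

namespace BatchedExperiment

variable {Ω : Type*}

/-- The batch of index `k`: all units assigned to batch `k` by the batch map `b`. -/
def batch {n K : ℕ} (b : Fin n → Fin K) (k : Fin K) : Finset (Fin n) :=
  Finset.univ.filter fun i => b i = k

/-- The AIPW estimator with (possibly random) model estimates `μ̂⁽¹⁾, μ̂⁽⁰⁾`, where unit `i`
has propensity score `e_{b i}` (the batch-level propensity). -/
noncomputable def tauHatAIPW (n K : ℕ) (b : Fin n → Fin K)
    (eb : Fin K → Ω → ℝ) (W Y : Fin n → Ω → ℝ) (muhat1 muhat0 : Ω → ℝ) (ω : Ω) : ℝ :=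
  muhat1 ω - muhat0 ω + (1 / (n : ℝ)) * ∑ i : Fin n,
    ((Y i ω - muhat1 ω) * W i ω / eb (b i) ω
      - (Y i ω - muhat0 ω) * (1 - W i ω) / (1 - eb (b i) ω))

/-- The intermediary estimator `τ̂₂`, i.e. the AIPW estimator using the true arm means. -/
noncomputable def tauHat2 (n K : ℕ) (b : Fin n → Fin K)
    (eb : Fin K → Ω → ℝ) (W Y : Fin n → Ω → ℝ) (μ1 μ0 : ℝ) (ω : Ω) : ℝ :=
  (μ1 - μ0) + (1 / (n : ℝ)) * ∑ i : Fin n,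
    ((Y i ω - μ1) * W i ω / eb (b i) ω - (Y i ω - μ0) * (1 - W i ω) / (1 - eb (b i) ω))

lemma sum_one_sub_div_eq_zero {ι : Type*} {s : Finset ι} {f : ι → ℝ} {c : ℝ} (hc : c ≠ 0)
    (h : ∑ i ∈ s, f i = c * s.card) : ∑ i ∈ s, (1 - f i / c) = 0 := by
  rw [Finset.sum_sub_distrib, ← Finset.sum_div, h, mul_div_cancel_left₀ _ hc]
  simp

lemma sum_one_sub_one_sub_div_eq_zero {ι : Type*} {s : Finset ι} {f : ι → ℝ} {c : ℝ}
    (hc : c ≠ 1) (h : ∑ i ∈ s, f i = c * s.card) :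
    ∑ i ∈ s, (1 - (1 - f i) / (1 - c)) = 0 := by
  refine sum_one_sub_div_eq_zero (sub_ne_zero.mpr hc.symm) ?_
  rw [Finset.sum_sub_distrib, h]
  simp
  ring

/-- Identities that hold batch by batch add up to an identity over all units. -/
lemma sum_eq_zero_of_sum_batch_eq_zero {n K : ℕ} {b : Fin n → Fin K}
    {g : Fin K → Fin n → ℝ}
    (h : ∀ k, ∑ i ∈ batch b k, g k i = 0) : ∑ i, g (b i) i = 0 := by
  rw [← Finset.sum_fiberwise Finset.univ b]
  refine Finset.sum_eq_zero fun k _ => (Finset.sum_congr rfl fun i hi => ?_).trans (h k)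
  rw [(Finset.mem_filter.mp hi).2]

/-- With balanced inverse propensity weights, the AIPW estimator does not depend on the
model estimates. -/
lemma tauHatAIPW_eq_tauHat2 {n K : ℕ} (hn : n ≠ 0) {b : Fin n → Fin K}
    {eb : Fin K → Ω → ℝ} {W : Fin n → Ω → ℝ} (Y : Fin n → Ω → ℝ) (μ1 μ0 : ℝ)
    (muhat1 muhat0 : Ω → ℝ) {ω : Ω}
    (h1 : ∀ k, ∑ i ∈ batch b k, (1 - W i ω / eb k ω) = 0)
    (h0 : ∀ k, ∑ i ∈ batch b k, (1 - (1 - W i ω) / (1 - eb k ω)) = 0) :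
    tauHatAIPW n K b eb W Y muhat1 muhat0 ω = tauHat2 n K b eb W Y μ1 μ0 ω := by
  have H1 := sum_eq_zero_of_sum_batch_eq_zero h1
  have H0 := sum_eq_zero_of_sum_batch_eq_zero h0
  have key : ∑ i : Fin n, ((Y i ω - muhat1 ω) * W i ω / eb (b i) ω
        - (Y i ω - muhat0 ω) * (1 - W i ω) / (1 - eb (b i) ω))
      = ∑ i : Fin n, ((Y i ω - μ1) * W i ω / eb (b i) ω
        - (Y i ω - μ0) * (1 - W i ω) / (1 - eb (b i) ω))
      + (muhat1 ω - μ1) * ∑ i, (1 - W i ω / eb (b i) ω)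
      - (muhat0 ω - μ0) * ∑ i, (1 - (1 - W i ω) / (1 - eb (b i) ω))
      - n * ((muhat1 ω - muhat0 ω) - (μ1 - μ0)) := by
    have hconst : (n : ℝ) * ((muhat1 ω - muhat0 ω) - (μ1 - μ0))
        = ∑ _i : Fin n, ((muhat1 ω - muhat0 ω) - (μ1 - μ0)) := by
      rw [Finset.sum_const, Finset.card_univ, Fintype.card_fin, nsmul_eq_mul]
    rw [hconst, Finset.mul_sum, Finset.mul_sum, ← Finset.sum_add_distrib,
      ← Finset.sum_sub_distrib, ← Finset.sum_sub_distrib]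
    exact Finset.sum_congr rfl fun i _ => by ring
  have hn' : (n : ℝ) ≠ 0 := Nat.cast_ne_zero.mpr hn
  rw [tauHatAIPW, tauHat2, key, H1, H0]
  field_simp
  ring

/-- Under batched incomplete randomization (within batch `k`, exactly
`e_k·γ_k` of the `γ_k` units receive treatment), for every batch `k`:
`Σ_{i ∈ batch k} (1 − Wᵢ/e_k) = 0` and `Σ_{i ∈ batch k} (1 − (1 − Wᵢ)/(1 − e_k)) = 0`
almost surely; consequently the AIPW estimator `τ̂₁` (with arbitrary, possibly random,
model estimates `μ̂⁽¹⁾, μ̂⁽⁰⁾`) equals the intermediary estimator `τ̂₂` almost surely, and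
the cross term satisfies `E[(τ̂₁ − τ̂₂)(τ̂₂ − τ)] = 0`. -/
theorem statement_2 [MeasurableSpace Ω] (P : Measure Ω) [IsProbabilityMeasure P]
    (n K : ℕ) (hn : 1 ≤ n) (γ : Fin K → ℕ) (b : Fin n → Fin K)
    (hcard : ∀ k, (batch b k).card = γ k)
    (W Y : Fin n → Ω → ℝ) (eb : Fin K → Ω → ℝ)
    (hW : ∀ i ω, W i ω = 0 ∨ W i ω = 1)
    (he : ∀ k ω, eb k ω ∈ Set.Ioo (0 : ℝ) 1)
    -- incomplete randomization: exactly `e_k·γ_k` treated units in batch `k`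
    (hcount : ∀ k, ∀ᵐ ω ∂P, ∑ i ∈ batch b k, W i ω = eb k ω * γ k)
    (μ1 μ0 : ℝ) (muhat1 muhat0 : Ω → ℝ) :
    (∀ k, ∀ᵐ ω ∂P, ∑ i ∈ batch b k, (1 - W i ω / eb k ω) = 0) ∧
    (∀ k, ∀ᵐ ω ∂P, ∑ i ∈ batch b k, (1 - (1 - W i ω) / (1 - eb k ω)) = 0) ∧
    (tauHatAIPW n K b eb W Y muhat1 muhat0 =ᵐ[P] tauHat2 n K b eb W Y μ1 μ0) ∧
    (∫ ω, (tauHatAIPW n K b eb W Y muhat1 muhat0 ω - tauHat2 n K b eb W Y μ1 μ0 ω) *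
        (tauHat2 n K b eb W Y μ1 μ0 ω - (μ1 - μ0)) ∂P = 0) := by
  have h1 : ∀ k, ∀ᵐ ω ∂P, ∑ i ∈ batch b k, (1 - W i ω / eb k ω) = 0 := fun k => by
    filter_upwards [hcount k] with ω hω
    exact sum_one_sub_div_eq_zero (he k ω).1.ne' (by rw [hω, hcard])
  have h0 : ∀ k, ∀ᵐ ω ∂P, ∑ i ∈ batch b k, (1 - (1 - W i ω) / (1 - eb k ω)) = 0 := fun k => by
    filter_upwards [hcount k] with ω hω
    exact sum_one_sub_one_sub_div_eq_zero (he k ω).2.ne (by rw [hω, hcard])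
  have heq : tauHatAIPW n K b eb W Y muhat1 muhat0 =ᵐ[P] tauHat2 n K b eb W Y μ1 μ0 := by
    filter_upwards [ae_all_iff.mpr h1, ae_all_iff.mpr h0] with ω hω1 hω0
    exact tauHatAIPW_eq_tauHat2 (Nat.one_le_iff_ne_zero.mp hn) Y μ1 μ0 muhat1 muhat0 hω1 hω0
  refine ⟨h1, h0, heq, integral_eq_zero_of_ae ?_⟩
  filter_upwards [heq] with ω hω
  simp [hω]

end BatchedExperiment
end

section
/- Under batched incomplete randomization, the AIPW estimator τ̂₁ equals the weighted difference-in-means estimator: τ̂₁ = Σ_{k=1}^K (γ_k/n) · τ̂_{k,DM}, where τ̂_{k,DM} = (Σ_{i ∈ batch k} W_i Y_i)/(Σ_{i ∈ batch k} W_i) − (Σ_{i ∈ batch k} (1 − W_i) Y_i)/(Σ_{i ∈ batch k} (1 − W_i)). -/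
open MeasureTheory ProbabilityTheory

namespace BatchedExperiment

variable {Ω : Type*}

/-- The within-batch difference-in-means estimator `τ̂_{k,DM}`. -/
noncomputable def tauDM (n K : ℕ) (b : Fin n → Fin K) (W Y : Fin n → Ω → ℝ)
    (k : Fin K) (ω : Ω) : ℝ :=
  (∑ i ∈ batch b k, W i ω * Y i ω) / (∑ i ∈ batch b k, W i ω)
    - (∑ i ∈ batch b k, (1 - W i ω) * Y i ω) / (∑ i ∈ batch b k, (1 - W i ω))

/-- The inverse-propensity-weighted arm residuals of a finite set of units sum to its size times
the difference between the arm mean and the model estimate. -/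
theorem sum_residual_div_eq {ι : Type*} (s : Finset ι) (V y : ι → ℝ) (m e g : ℝ) (h0 : e ≠ 0)
    (hV : ∑ i ∈ s, V i = e * g) (hg : g = 0 → s = ∅) :
    ∑ i ∈ s, (y i - m) * V i / e = g * ((∑ i ∈ s, V i * y i) / ∑ i ∈ s, V i) - g * m := by
  by_cases h : g = 0
  · simp [hg h, h]
  · have expand : ∑ i ∈ s, (y i - m) * V i = ∑ i ∈ s, V i * y i - m * ∑ i ∈ s, V i := by
      rw [Finset.mul_sum, ← Finset.sum_sub_distrib]
      exact Finset.sum_congr rfl fun i _ => by ring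
    rw [← Finset.sum_div, expand, hV]
    field_simp

/-- Under batched incomplete randomization, the AIPW estimator equals the
weighted difference-in-means estimator: `τ̂₁ = Σ_k (γ_k/n)·τ̂_{k,DM}` almost surely. -/
theorem statement_3 [MeasurableSpace Ω] (P : Measure Ω) [IsProbabilityMeasure P]
    (n K : ℕ) (hn : 1 ≤ n) (γ : Fin K → ℕ) (b : Fin n → Fin K)
    (hcard : ∀ k, (batch b k).card = γ k)
    (W Y : Fin n → Ω → ℝ) (eb : Fin K → Ω → ℝ)
    (hW : ∀ i ω, W i ω = 0 ∨ W i ω = 1)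
    (he : ∀ k ω, eb k ω ∈ Set.Ioo (0 : ℝ) 1)
    -- incomplete randomization: exactly `e_k·γ_k` treated units in batch `k`
    (hcount : ∀ k, ∀ᵐ ω ∂P, ∑ i ∈ batch b k, W i ω = eb k ω * γ k)
    (muhat1 muhat0 : Ω → ℝ) :
    ∀ᵐ ω ∂P, tauHatAIPW n K b eb W Y muhat1 muhat0 ω =
      ∑ k : Fin K, ((γ k : ℝ) / n) * tauDM n K b W Y k ω := by
  filter_upwards [ae_all_iff.2 hcount] with ω hω
  have hn0 : (n : ℝ) ≠ 0 := by positivity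
  have hempty (k : Fin K) : (γ k : ℝ) = 0 → batch b k = ∅ := fun h => by
    rw [← Finset.card_eq_zero, hcard]
    exact_mod_cast h
  have htotal : ∑ k, (γ k : ℝ) = n := by
    have h := Finset.card_eq_sum_card_fiberwise (f := b) (s := Finset.univ) (t := Finset.univ)
      fun _ _ => Finset.mem_coe.2 (Finset.mem_univ _)
    rw [Finset.card_univ, Fintype.card_fin] at h
    rw [h, Nat.cast_sum]
    exact Finset.sum_congr rfl fun k _ => by rw [← hcard k]; rfl
  have hbatch (k : Fin K) : ∑ i ∈ batch b k,
      ((Y i ω - muhat1 ω) * W i ω / eb (b i) ω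
        - (Y i ω - muhat0 ω) * (1 - W i ω) / (1 - eb (b i) ω))
      = γ k * tauDM n K b W Y k ω - γ k * (muhat1 ω - muhat0 ω) := by
    have hcontrol : ∑ i ∈ batch b k, (1 - W i ω) = (1 - eb k ω) * γ k := by
      rw [Finset.sum_sub_distrib, hω k, Finset.sum_const, hcard, nsmul_eq_mul]
      ring
    have h1 := sum_residual_div_eq (batch b k) (fun i => W i ω) (fun i => Y i ω) (muhat1 ω)
      (eb k ω) (γ k) (he k ω).1.ne' (hω k) (hempty k)
    have h0 := sum_residual_div_eq (batch b k) (fun i => 1 - W i ω) (fun i => Y i ω) (muhat0 ω)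
      (1 - eb k ω) (γ k) (sub_pos.2 (he k ω).2).ne' hcontrol (hempty k)
    have hprop : ∀ i ∈ batch b k, b i = k := fun i hi => (Finset.mem_filter.1 hi).2
    rw [Finset.sum_congr rfl fun i hi => by rw [hprop i hi], Finset.sum_sub_distrib, h1, h0, tauDM]
    ring
  have hsplit := Finset.sum_fiberwise Finset.univ b fun i =>
    ((Y i ω - muhat1 ω) * W i ω / eb (b i) ω
      - (Y i ω - muhat0 ω) * (1 - W i ω) / (1 - eb (b i) ω))
  have hsum := hsplit.symm.trans
    ((Finset.sum_congr rfl fun k _ => hbatch k).trans (Finset.sum_sub_distrib _ _))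
  rw [← Finset.sum_mul, htotal] at hsum
  simp_rw [tauHatAIPW, hsum, div_mul_eq_mul_div, ← Finset.sum_div]
  field_simp
  ring

end BatchedExperiment
end

section
/- Under batched incomplete randomization with propensities e_k = σ̃₁^{(k−1)}/(σ̃₁^{(k−1)} + σ̃₀^{(k−1)}), the weighted difference-in-means estimator τ̂_ADM = Σ_{k=1}^K (γ_k/n) τ̂_{k,DM} is unbiased and satisfies the exact decomposition E[(τ̂_ADM − τ)²] = (σ⁽¹⁾ + σ⁽⁰⁾)²/n + Σ_{k=1}^K (γ_k/n²) · E[ (σ⁽¹⁾/σ̃₁^{(k−1)} − σ⁽⁰⁾/σ̃₀^{(k−1)})² · σ̃₁^{(k−1)} σ̃₀^{(k−1)} ]. -/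
open MeasureTheory ProbabilityTheory

namespace BatchedExperiment

variable {Ω : Type*}

/-- The weighted difference-in-means estimator `τ̂_ADM = Σ_k (γ_k/n)·τ̂_{k,DM}`. -/
noncomputable def tauADM (n K : ℕ) (γ : Fin K → ℕ) (b : Fin n → Fin K)
    (W Y : Fin n → Ω → ℝ) (ω : Ω) : ℝ :=
  ∑ k : Fin K, ((γ k : ℝ) / n) * tauDM n K b W Y k ω

/-- The σ-algebra generated by the batch-`k` information `G k` together with the treatment
assignments of batch `k`. -/
def HW [MeasurableSpace Ω] {n K : ℕ} (G : ℕ → MeasurableSpace Ω) (b : Fin n → Fin K)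
    (W : Fin n → Ω → ℝ) (k : Fin K) : MeasurableSpace Ω :=
  G k.val ⊔ ⨆ i ∈ batch b k, MeasurableSpace.comap (W i) (inferInstance : MeasurableSpace ℝ)

/-- The coefficient of the outcome of unit `i` in the difference-in-means estimator of its
batch. -/
noncomputable def weight {n K : ℕ} (b : Fin n → Fin K) (W : Fin n → Ω → ℝ) (i : Fin n)
    (ω : Ω) : ℝ :=
  W i ω / (∑ j ∈ batch b (b i), W j ω) - (1 - W i ω) / (∑ j ∈ batch b (b i), (1 - W j ω))

/-- The deviation of the outcome of unit `i` from its mean given the treatment. -/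
def residual {n : ℕ} (μ1 μ0 : ℝ) (W Y : Fin n → Ω → ℝ) (i : Fin n) (ω : Ω) : ℝ :=
  Y i ω - (μ1 * W i ω + μ0 * (1 - W i ω))

section Pointwise

variable {n K : ℕ} {b : Fin n → Fin K} {W Y : Fin n → Ω → ℝ}

lemma mem_batch {k : Fin K} {i : Fin n} : i ∈ batch b k ↔ b i = k := by
  simp [batch]

lemma sum_card_batch (b : Fin n → Fin K) : ∑ k, ((batch b k).card : ℝ) = n := by
  have h := Finset.card_eq_sum_card_fiberwise (f := b) (s := Finset.univ)
    (t := Finset.univ) (by simp)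
  rw [Finset.card_univ, Fintype.card_fin] at h
  exact_mod_cast h.symm

lemma abs_weight_le_one (hW : ∀ i ω, W i ω = 0 ∨ W i ω = 1) (i : Fin n) (ω : Ω) :
    |weight b W i ω| ≤ 1 := by
  have hi : i ∈ batch b (b i) := mem_batch.2 rfl
  have h1 : W i ω ≤ ∑ j ∈ batch b (b i), W j ω :=
    Finset.single_le_sum (f := fun j => W j ω)
      (fun j _ => by rcases hW j ω with h | h <;> simp [h]) hi
  have h0 : 1 - W i ω ≤ ∑ j ∈ batch b (b i), (1 - W j ω) :=
    Finset.single_le_sum (f := fun j => 1 - W j ω)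
      (fun j _ => by rcases hW j ω with h | h <;> simp [h]) hi
  unfold weight
  rcases hW i ω with h | h
  · rw [h, sub_zero] at h0
    rw [h, sub_zero, zero_div, zero_sub, abs_neg, abs_of_nonneg (by positivity)]
    exact div_le_one_of_le₀ h0 (by linarith)
  · rw [h] at h1
    rw [h, sub_self, zero_div, sub_zero, abs_of_nonneg (by positivity)]
    exact div_le_one_of_le₀ h1 (by linarith)

lemma tauDM_sub_eq_sum_weight_mul_residual (hW : ∀ i ω, W i ω = 0 ∨ W i ω = 1) (μ1 μ0 : ℝ)
    (k : Fin K) (ω : Ω) (h1 : ∑ i ∈ batch b k, W i ω ≠ 0)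
    (h0 : ∑ i ∈ batch b k, (1 - W i ω) ≠ 0) :
    tauDM n K b W Y k ω - (μ1 - μ0) =
      ∑ i ∈ batch b k, weight b W i ω * residual μ1 μ0 W Y i ω := by
  have key : ∀ i ∈ batch b k, weight b W i ω * residual μ1 μ0 W Y i ω =
      W i ω * Y i ω / (∑ i ∈ batch b k, W i ω)
        - (1 - W i ω) * Y i ω / (∑ i ∈ batch b k, (1 - W i ω))
        - (μ1 * (W i ω / (∑ i ∈ batch b k, W i ω))
          - μ0 * ((1 - W i ω) / (∑ i ∈ batch b k, (1 - W i ω)))) := by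
    intro i hi
    rw [weight, residual, mem_batch.1 hi]
    rcases hW i ω with h | h <;> rw [h] <;> ring
  rw [Finset.sum_congr rfl key, tauDM]
  generalize hN1 : ∑ i ∈ batch b k, W i ω = N1 at *
  generalize hN0 : ∑ i ∈ batch b k, (1 - W i ω) = N0 at *
  rw [Finset.sum_sub_distrib, Finset.sum_sub_distrib, Finset.sum_sub_distrib, ← Finset.sum_div,
    ← Finset.sum_div, ← Finset.mul_sum, ← Finset.mul_sum, ← Finset.sum_div, ← Finset.sum_div,
    hN1, hN0, div_self h1, div_self h0, mul_one, mul_one]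

lemma sum_weight_sq_mul (hW : ∀ i ω, W i ω = 0 ∨ W i ω = 1) (v1 v0 : ℝ)
    (k : Fin K) (ω : Ω) (h1 : ∑ i ∈ batch b k, W i ω ≠ 0)
    (h0 : ∑ i ∈ batch b k, (1 - W i ω) ≠ 0) :
    ∑ i ∈ batch b k, weight b W i ω ^ 2 * (v1 * W i ω + v0 * (1 - W i ω)) =
      v1 / (∑ i ∈ batch b k, W i ω) + v0 / (∑ i ∈ batch b k, (1 - W i ω)) := by
  have key : ∀ i ∈ batch b k, weight b W i ω ^ 2 * (v1 * W i ω + v0 * (1 - W i ω)) =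
      v1 / (∑ i ∈ batch b k, W i ω) ^ 2 * W i ω
        + v0 / (∑ i ∈ batch b k, (1 - W i ω)) ^ 2 * (1 - W i ω) := by
    intro i hi
    rw [weight, mem_batch.1 hi]
    rcases hW i ω with h | h <;> rw [h] <;> ring
  rw [Finset.sum_congr rfl key, Finset.sum_add_distrib, ← Finset.mul_sum, ← Finset.mul_sum]
  field_simp

lemma sum_one_sub_eq {k : Fin K} {g s1 s0 : ℝ} {ω : Ω} (hs1 : 0 < s1) (hs0 : 0 < s0)
    (hg : ((batch b k).card : ℝ) = g) (h : ∑ i ∈ batch b k, W i ω = s1 / (s1 + s0) * g) :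
    ∑ i ∈ batch b k, (1 - W i ω) = s0 / (s1 + s0) * g := by
  rw [Finset.sum_sub_distrib, h, Finset.sum_const, nsmul_eq_mul, hg]
  field_simp
  ring

lemma neyman_variance_eq {g N s1 s0 : ℝ} (hg : g ≠ 0) (hs1 : 0 < s1) (hs0 : 0 < s0)
    (σ1 σ0 : ℝ) :
    (g / N) ^ 2 * (σ1 ^ 2 / (s1 / (s1 + s0) * g) + σ0 ^ 2 / (s0 / (s1 + s0) * g)) =
      g / N ^ 2 * ((σ1 + σ0) ^ 2 + (σ1 / s1 - σ0 / s0) ^ 2 * (s1 * s0)) := by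
  have : s1 + s0 ≠ 0 := by positivity
  field_simp
  ring

end Pointwise

lemma HW_le [MeasurableSpace Ω] {n K : ℕ} {G : ℕ → MeasurableSpace Ω}
    {b : Fin n → Fin K} {W : Fin n → Ω → ℝ} {k : Fin K} {m : MeasurableSpace Ω}
    (hG : G k.val ≤ m) (hW : ∀ i ∈ batch b k, Measurable[m] (W i)) : HW G b W k ≤ m :=
  sup_le hG (iSup₂_le fun i hi => (hW i hi).comap_le)

lemma measurable_HW [MeasurableSpace Ω] {n K : ℕ} (G : ℕ → MeasurableSpace Ω)
    (b : Fin n → Fin K) (W : Fin n → Ω → ℝ) {k : Fin K} {i : Fin n} (hi : i ∈ batch b k) :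
    Measurable[HW G b W k] (W i) :=
  measurable_iff_comap_le.2 <| (le_iSup₂ (f := fun i (_ : i ∈ batch b k) =>
    MeasurableSpace.comap (W i) (inferInstance : MeasurableSpace ℝ)) i hi).trans le_sup_right

lemma measurable_weight {m : MeasurableSpace Ω} {n K : ℕ} {b : Fin n → Fin K}
    {W : Fin n → Ω → ℝ} {i : Fin n} (hW : ∀ j ∈ batch b (b i), Measurable (W j)) :
    Measurable (weight b W i) := by
  have hi := hW i (mem_batch.2 rfl)
  exact (hi.div (Finset.measurable_fun_sum _ hW)).sub ((measurable_const.sub hi).div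
    (Finset.measurable_fun_sum _ fun j hj => measurable_const.sub (hW j hj)))

lemma integral_mul_eq_of_condExp {m m0 : MeasurableSpace Ω} {P : Measure Ω}
    [IsProbabilityMeasure P] (hm : m ≤ m0) {c f g : Ω → ℝ} (hc : Measurable[m] c)
    (hcf : Integrable (fun ω => c ω * f ω) P) (hf : Integrable f P) (hg : P[f|m] =ᵐ[P] g) :
    ∫ ω, c ω * f ω ∂P = ∫ ω, c ω * g ω ∂P := by
  rw [← integral_condExp hm]
  refine integral_congr_ae ?_
  filter_upwards [condExp_mul_of_stronglyMeasurable_left hc.stronglyMeasurable hcf hf, hg]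
    with ω h1 h2
  rw [← h2]
  exact h1

/-- Under batched incomplete randomization with batch-`k` propensity
`e_k = σ̃₁^{(k−1)}/(σ̃₁^{(k−1)} + σ̃₀^{(k−1)})`, the weighted difference-in-means estimator
`τ̂_ADM` is unbiased and satisfies the exact variance decomposition
`E[(τ̂_ADM − τ)²] = (σ⁽¹⁾+σ⁽⁰⁾)²/n
  + Σ_k (γ_k/n²)·E[(σ⁽¹⁾/σ̃₁^{(k−1)} − σ⁽⁰⁾/σ̃₀^{(k−1)})²·σ̃₁^{(k−1)}σ̃₀^{(k−1)}]`. -/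
theorem statement_4 [m0 : MeasurableSpace Ω] (P : Measure Ω) [IsProbabilityMeasure P]
    (n K : ℕ) (hn : 1 ≤ n) (γ : Fin K → ℕ) (b : Fin n → Fin K)
    (hcard : ∀ k, (batch b k).card = γ k)
    (G : ℕ → MeasurableSpace Ω) (hG_mono : Monotone G) (hG_le : ∀ j, G j ≤ m0)
    (W Y : Fin n → Ω → ℝ) (σt1 σt0 : Fin K → Ω → ℝ)
    (μ1 μ0 σ1 σ0 : ℝ) (hσ1 : 0 < σ1) (hσ0 : 0 < σ0)
    -- the variance estimates used in batch `k` are built from the data of batches `1,…,k−1`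
    (hσt_meas1 : ∀ k : Fin K, Measurable[G k.val] (σt1 k))
    (hσt_meas0 : ∀ k : Fin K, Measurable[G k.val] (σt0 k))
    (hσt1_pos : ∀ k ω, 0 < σt1 k ω) (hσt0_pos : ∀ k ω, 0 < σt0 k ω)
    (hW : ∀ i ω, W i ω = 0 ∨ W i ω = 1)
    -- the data of batch `k` is measurable with respect to `G (k+1)`
    (hW_meas : ∀ i : Fin n, Measurable[G ((b i).val + 1)] (W i))
    (hY_meas : ∀ i : Fin n, Measurable[G ((b i).val + 1)] (Y i))
    -- incomplete randomization: exactly `e_k·γ_k` treated units in batch `k`, where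
    -- `e_k = σ̃₁^{(k−1)}/(σ̃₁^{(k−1)}+σ̃₀^{(k−1)})`
    (hcount : ∀ k, ∀ᵐ ω ∂P, ∑ i ∈ batch b k, W i ω =
      σt1 k ω / (σt1 k ω + σt0 k ω) * γ k)
    -- conditional mean, conditional variance, and conditional uncorrelatedness of
    -- the outcomes given the past and the assignments of the current batch
    (hY_mean : ∀ k : Fin K, ∀ i ∈ batch b k,
      P[Y i|HW G b W k] =ᵐ[P] fun ω => μ1 * W i ω + μ0 * (1 - W i ω))
    (hY_var : ∀ k : Fin K, ∀ i ∈ batch b k,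
      P[(fun ω => (Y i ω - (μ1 * W i ω + μ0 * (1 - W i ω))) ^ 2)|HW G b W k]
        =ᵐ[P] fun ω => σ1 ^ 2 * W i ω + σ0 ^ 2 * (1 - W i ω))
    (hY_uncorr : ∀ k : Fin K, ∀ i ∈ batch b k, ∀ j ∈ batch b k, i ≠ j →
      P[(fun ω => (Y i ω - (μ1 * W i ω + μ0 * (1 - W i ω))) *
          (Y j ω - (μ1 * W j ω + μ0 * (1 - W j ω))))|HW G b W k] =ᵐ[P] fun _ => 0)
    -- integrability of all the quantities appearing below
    (hint_Y_sq : ∀ i, Integrable (fun ω => (Y i ω) ^ 2) P)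
    (hint_DM_sq : ∀ k, Integrable (fun ω => (tauDM n K b W Y k ω) ^ 2) P)
    (hint_ADM_sq : Integrable (fun ω => (tauADM n K γ b W Y ω - (μ1 - μ0)) ^ 2) P)
    (hint_σt : ∀ k, Integrable
      (fun ω => (σ1 / σt1 k ω - σ0 / σt0 k ω) ^ 2 * (σt1 k ω * σt0 k ω)) P) :
    (∫ ω, tauADM n K γ b W Y ω ∂P = μ1 - μ0) ∧
    (∫ ω, (tauADM n K γ b W Y ω - (μ1 - μ0)) ^ 2 ∂P =
      (σ1 + σ0) ^ 2 / n + ∑ k : Fin K, ((γ k : ℝ) / (n : ℝ) ^ 2) *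
        ∫ ω, (σ1 / σt1 k ω - σ0 / σt0 k ω) ^ 2 * (σt1 k ω * σt0 k ω) ∂P) := by
  have hn0 : (n : ℝ) ≠ 0 := by positivity
  have hγ_sum : ∑ k, (γ k : ℝ) = n := by
    simpa only [hcard] using sum_card_batch b
  have hG1 : ∀ i, G ((b i).val + 1) ≤ m0 := fun i => hG_le _
  have hWm : ∀ i, Measurable (W i) := fun i => (hW_meas i).mono (hG1 i) le_rfl
  have hYm : ∀ i, Measurable (Y i) := fun i => (hY_meas i).mono (hG1 i) le_rfl
  have hHle : ∀ k, HW G b W k ≤ m0 := fun k => HW_le (hG_le _) fun i _ => hWm i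
  have hresm : ∀ i, Measurable[G ((b i).val + 1)] (residual μ1 μ0 W Y i) := fun i =>
    (hY_meas i).sub (((hW_meas i).const_mul μ1).add
      ((measurable_const.sub (hW_meas i)).const_mul μ0))
  have hwH : ∀ i, Measurable[HW G b W (b i)] (weight b W i) := fun i =>
    measurable_weight fun j hj => measurable_HW G b W hj
  have hwG : ∀ i, Measurable[G ((b i).val + 1)] (weight b W i) := fun i =>
    measurable_weight fun j hj => by
      have := hW_meas j
      rwa [mem_batch.1 hj] at this
  have hWL : ∀ i, MemLp (W i) 2 P := fun i =>
    MemLp.of_bound (hWm i).aestronglyMeasurable 1 <| .of_forall fun ω => by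
      rcases hW i ω with h | h <;> simp [h]
  have hYL : ∀ i, MemLp (Y i) 2 P := fun i =>
    (memLp_two_iff_integrable_sq (hYm i).aestronglyMeasurable).2 (hint_Y_sq i)
  have hresL : ∀ i, MemLp (residual μ1 μ0 W Y i) 2 P := fun i =>
    (hYL i).sub (((hWL i).const_mul μ1).add (((memLp_const 1).sub (hWL i)).const_mul μ0))
  have hprodL : ∀ i, MemLp (fun ω => weight b W i ω * residual μ1 μ0 W Y i ω) 2 P := fun i =>
    (hresL i).of_le_mul (c := 1)
      (((hwG i).mul (hresm i)).mono (hG1 i) le_rfl).aestronglyMeasurable <| .of_forall fun ω => by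
        rw [norm_mul]
        exact mul_le_mul_of_nonneg_right (abs_weight_le_one hW i ω) (norm_nonneg _)
  have hresmean : ∀ i, P[residual μ1 μ0 W Y i|HW G b W (b i)] =ᵐ[P] fun _ => 0 := by
    intro i
    have hi : i ∈ batch b (b i) := mem_batch.2 rfl
    have hmi := measurable_HW G b W hi
    have hmean : Measurable[HW G b W (b i)] fun ω => μ1 * W i ω + μ0 * (1 - W i ω) :=
      (hmi.const_mul μ1).add ((measurable_const.sub hmi).const_mul μ0)
    have hmeanL : MemLp (fun ω => μ1 * W i ω + μ0 * (1 - W i ω)) 2 P :=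
      ((hWL i).const_mul μ1).add (((memLp_const 1).sub (hWL i)).const_mul μ0)
    have hmeani := hmeanL.integrable one_le_two
    have h := condExp_sub ((hYL i).integrable one_le_two) hmeani (HW G b W (b i))
    rw [condExp_of_stronglyMeasurable (hHle _) hmean.stronglyMeasurable hmeani] at h
    filter_upwards [h, hY_mean (b i) i hi] with ω h1 h2
    refine Eq.trans h1 ?_
    rw [Pi.sub_apply, h2, sub_self]
  -- the estimation error is a weighted sum of residuals
  have herr : ∀ᵐ ω ∂P, tauADM n K γ b W Y ω - (μ1 - μ0) =
      ∑ i, (γ (b i) : ℝ) / n * (weight b W i ω * residual μ1 μ0 W Y i ω) := by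
    filter_upwards [ae_all_iff.2 hcount] with ω hω
    have hsum : ∑ k, (γ k : ℝ) / n = 1 := by
      rw [← Finset.sum_div, hγ_sum, div_self hn0]
    have hfib : ∑ i, (γ (b i) : ℝ) / n * (weight b W i ω * residual μ1 μ0 W Y i ω) =
        ∑ k, (γ k : ℝ) / n *
          ∑ i ∈ batch b k, weight b W i ω * residual μ1 μ0 W Y i ω := by
      rw [← Finset.sum_fiberwise Finset.univ b]
      refine Finset.sum_congr rfl fun k _ => ?_
      rw [Finset.mul_sum]
      exact Finset.sum_congr rfl fun i hi => by rw [mem_batch.1 hi]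
    rw [hfib, tauADM]
    calc _ = ∑ k, (γ k : ℝ) / n * (tauDM n K b W Y k ω - (μ1 - μ0)) := by
          simp_rw [mul_sub]
          rw [Finset.sum_sub_distrib, Finset.sum_sub_distrib, ← Finset.sum_mul, ← Finset.sum_mul,
            hsum, one_mul, one_mul]
      _ = _ := by
          refine Finset.sum_congr rfl fun k _ => ?_
          by_cases hk : γ k = 0
          · simp [hk]
          have hg : (γ k : ℝ) ≠ 0 := by exact_mod_cast hk
          have hs1 := hσt1_pos k ω
          have hs0 := hσt0_pos k ω
          have hc0 := sum_one_sub_eq hs1 hs0 (by rw [hcard k]) (hω k)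
          rw [tauDM_sub_eq_sum_weight_mul_residual hW μ1 μ0 k ω (by rw [hω k]; positivity)
            (by rw [hc0]; positivity)]
  have hmean0 : ∀ i, ∫ ω, weight b W i ω * residual μ1 μ0 W Y i ω ∂P = 0 := fun i => by
    rw [integral_mul_eq_of_condExp (hHle (b i)) (hwH i) ((hprodL i).integrable one_le_two)
      ((hresL i).integrable one_le_two) (hresmean i)]
    simp
  have hpp : ∀ i j, Integrable (fun ω => (weight b W i ω * residual μ1 μ0 W Y i ω) *
      (weight b W j ω * residual μ1 μ0 W Y j ω)) P := fun i j =>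
    (hprodL i).integrable_mul (hprodL j)
  have hcross_lt : ∀ i j, b i < b j → ∫ ω, (weight b W i ω * residual μ1 μ0 W Y i ω) *
      (weight b W j ω * residual μ1 μ0 W Y j ω) ∂P = 0 := by
    intro i j hij
    have hle : G ((b i).val + 1) ≤ HW G b W (b j) := (hG_mono hij).trans le_sup_left
    have hi := ((hwG i).mul (hresm i)).mono hle le_rfl
    have h := integral_mul_eq_of_condExp (f := residual μ1 μ0 W Y j) (hHle (b j))
      (hi.mul (hwH j)) ((hpp i j).congr <| .of_forall fun ω => (mul_assoc _ _ _).symm)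
      ((hresL j).integrable one_le_two) (hresmean j)
    simp only [mul_zero, integral_zero] at h
    rw [← h]
    exact integral_congr_ae <| .of_forall fun ω => (mul_assoc _ _ _).symm
  have hrr : ∀ i j, Integrable (fun ω => residual μ1 μ0 W Y i ω * residual μ1 μ0 W Y j ω) P :=
    fun i j => (hresL i).integrable_mul (hresL j)
  have hcross : ∀ i j, i ≠ j → ∫ ω, (weight b W i ω * residual μ1 μ0 W Y i ω) *
      (weight b W j ω * residual μ1 μ0 W Y j ω) ∂P = 0 := by
    intro i j hij
    rcases lt_trichotomy (b i) (b j) with h | h | h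
    · exact hcross_lt i j h
    · have hwj := hwH j
      rw [← h] at hwj
      have h' := integral_mul_eq_of_condExp (hHle (b i)) ((hwH i).mul hwj)
        ((hpp i j).congr <| .of_forall fun ω => mul_mul_mul_comm _ _ _ _) (hrr i j)
        (hY_uncorr (b i) i (mem_batch.2 rfl) j (mem_batch.2 h.symm) hij)
      simp only [mul_zero, integral_zero] at h'
      rw [← h']
      exact integral_congr_ae <| .of_forall fun ω => mul_mul_mul_comm _ _ _ _
    · rw [← hcross_lt j i h]
      exact integral_congr_ae <| .of_forall fun ω => mul_comm _ _
  have hdiag : ∀ i, ∫ ω, (weight b W i ω * residual μ1 μ0 W Y i ω) *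
      (weight b W i ω * residual μ1 μ0 W Y i ω) ∂P =
      ∫ ω, weight b W i ω ^ 2 * (σ1 ^ 2 * W i ω + σ0 ^ 2 * (1 - W i ω)) ∂P := by
    intro i
    have hsq : Integrable (fun ω => residual μ1 μ0 W Y i ω ^ 2) P := (hresL i).integrable_sq
    rw [← integral_mul_eq_of_condExp (hHle (b i)) ((hwH i).pow_const 2)
      ((hpp i i).congr <| .of_forall fun ω => by simp only [residual]; ring) hsq
      (hY_var (b i) i (mem_batch.2 rfl))]
    exact integral_congr_ae <| .of_forall fun ω => by simp only; ring
  have hdiagi : ∀ i, Integrable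
      (fun ω => weight b W i ω ^ 2 * (σ1 ^ 2 * W i ω + σ0 ^ 2 * (1 - W i ω))) P := by
    intro i
    have hw : Measurable (weight b W i) := (hwH i).mono (hHle _) le_rfl
    have hm : Measurable
        (fun ω => weight b W i ω ^ 2 * (σ1 ^ 2 * W i ω + σ0 ^ 2 * (1 - W i ω))) :=
      (hw.pow_const 2).mul (((hWm i).const_mul _).add ((measurable_const.sub (hWm i)).const_mul _))
    refine Integrable.of_bound hm.aestronglyMeasurable (σ1 ^ 2 + σ0 ^ 2) <| .of_forall fun ω => ?_
    have h1 : weight b W i ω ^ 2 ≤ 1 := (sq_le_one_iff_abs_le_one _).2 (abs_weight_le_one hW i ω)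
    have h2 : |σ1 ^ 2 * W i ω + σ0 ^ 2 * (1 - W i ω)| ≤ σ1 ^ 2 + σ0 ^ 2 := by
      rcases hW i ω with h | h <;> simp [h] <;> positivity
    rw [Real.norm_eq_abs, abs_mul, abs_of_nonneg (sq_nonneg (weight b W i ω))]
    exact (mul_le_of_le_one_left (abs_nonneg _) h1).trans h2
  constructor
  · have hint : Integrable (fun ω => ∑ i, (γ (b i) : ℝ) / n *
        (weight b W i ω * residual μ1 μ0 W Y i ω)) P :=
      integrable_finsetSum _ fun i _ => ((hprodL i).integrable one_le_two).const_mul _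
    have h : ∀ᵐ ω ∂P, tauADM n K γ b W Y ω = (μ1 - μ0) + ∑ i, (γ (b i) : ℝ) / n *
        (weight b W i ω * residual μ1 μ0 W Y i ω) := by
      filter_upwards [herr] with ω hω
      rw [← hω]
      ring
    rw [integral_congr_ae h, integral_add (integrable_const _) hint,
      integral_finsetSum _ fun i _ => ((hprodL i).integrable one_le_two).const_mul _]
    simp [integral_const_mul, hmean0]
  · have hexp : ∀ᵐ ω ∂P, (tauADM n K γ b W Y ω - (μ1 - μ0)) ^ 2 =
        ∑ i, ∑ j, ((γ (b i) : ℝ) / n * ((γ (b j) : ℝ) / n)) *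
          ((weight b W i ω * residual μ1 μ0 W Y i ω) *
            (weight b W j ω * residual μ1 μ0 W Y j ω)) := by
      filter_upwards [herr] with ω hω
      rw [hω, sq, Finset.sum_mul_sum]
      exact Finset.sum_congr rfl fun i _ => Finset.sum_congr rfl fun j _ =>
        mul_mul_mul_comm _ _ _ _
    have hdouble : ∫ ω, (tauADM n K γ b W Y ω - (μ1 - μ0)) ^ 2 ∂P =
        ∑ i, ∫ ω, ((γ (b i) : ℝ) / n) ^ 2 *
          (weight b W i ω ^ 2 * (σ1 ^ 2 * W i ω + σ0 ^ 2 * (1 - W i ω))) ∂P := by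
      rw [integral_congr_ae hexp, integral_finsetSum _ fun i _ =>
        integrable_finsetSum _ fun j _ => (hpp i j).const_mul _]
      refine Finset.sum_congr rfl fun i _ => ?_
      rw [integral_finsetSum _ fun j _ => (hpp i j).const_mul _, Finset.sum_eq_single i]
      · rw [integral_const_mul, integral_const_mul, hdiag, sq ((γ (b i) : ℝ) / n)]
      · intro j _ hji
        rw [integral_const_mul, hcross i j hji.symm, mul_zero]
      · simp
    have hbatch : ∀ k, ∑ i ∈ batch b k, ∫ ω, ((γ (b i) : ℝ) / n) ^ 2 *
          (weight b W i ω ^ 2 * (σ1 ^ 2 * W i ω + σ0 ^ 2 * (1 - W i ω))) ∂P =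
        (γ k : ℝ) / (n : ℝ) ^ 2 * (σ1 + σ0) ^ 2 + (γ k : ℝ) / (n : ℝ) ^ 2 *
          ∫ ω, (σ1 / σt1 k ω - σ0 / σt0 k ω) ^ 2 * (σt1 k ω * σt0 k ω) ∂P := by
      intro k
      rw [← integral_finsetSum _ fun i _ => (hdiagi i).const_mul _]
      have hae : ∀ᵐ ω ∂P, ∑ i ∈ batch b k, ((γ (b i) : ℝ) / n) ^ 2 *
          (weight b W i ω ^ 2 * (σ1 ^ 2 * W i ω + σ0 ^ 2 * (1 - W i ω))) =
          (γ k : ℝ) / (n : ℝ) ^ 2 * ((σ1 + σ0) ^ 2 +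
            (σ1 / σt1 k ω - σ0 / σt0 k ω) ^ 2 * (σt1 k ω * σt0 k ω)) := by
        filter_upwards [hcount k] with ω hω
        have hcongr : ∀ i ∈ batch b k, ((γ (b i) : ℝ) / n) ^ 2 *
            (weight b W i ω ^ 2 * (σ1 ^ 2 * W i ω + σ0 ^ 2 * (1 - W i ω))) =
            ((γ k : ℝ) / n) ^ 2 *
            (weight b W i ω ^ 2 * (σ1 ^ 2 * W i ω + σ0 ^ 2 * (1 - W i ω))) :=
          fun i hi => by rw [mem_batch.1 hi]
        rw [Finset.sum_congr rfl hcongr, ← Finset.mul_sum]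
        by_cases hk : γ k = 0
        · simp [hk]
        have hg : (γ k : ℝ) ≠ 0 := by exact_mod_cast hk
        have hs1 := hσt1_pos k ω
        have hs0 := hσt0_pos k ω
        have hc0 := sum_one_sub_eq hs1 hs0 (by rw [hcard k]) hω
        rw [sum_weight_sq_mul hW _ _ k ω (by rw [hω]; positivity) (by rw [hc0]; positivity),
          hω, hc0, neyman_variance_eq hg hs1 hs0]
      rw [integral_congr_ae hae, integral_const_mul,
        integral_add (integrable_const _) (hint_σt k), integral_const, probReal_univ, one_smul,
        mul_add]
    rw [hdouble, ← Finset.sum_fiberwise Finset.univ b]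
    refine (Finset.sum_congr rfl fun k _ => hbatch k).trans ?_
    rw [Finset.sum_add_distrib, ← Finset.sum_mul, ← Finset.sum_div, hγ_sum]
    congr 1
    field_simp

end BatchedExperiment
end

section
/- Theorem (lower bound without covariates): For every non-anticipating allocation mechanism and every measurable estimator τ̂ of the collected data 𝓕ₙ, there exist arm means μ⁽¹⁾, μ⁽⁰⁾ ∈ ℝ and standard deviations σ⁽¹⁾, σ⁽⁰⁾ > 0 such that, under the Gaussian instance with these parameters, E[(τ̂ − τ)²] ≥ (σ⁽¹⁾ + σ⁽⁰⁾)²/n + (σ⁽¹⁾ + σ⁽⁰⁾)²/(1000 n²), where τ = μ⁽¹⁾ − μ⁽⁰⁾. -/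
open MeasureTheory ProbabilityTheory
open scoped ENNReal

namespace LowerBound

/-- Extension of a finite vector to `ℕ` (by junk values), used to feed the finitely many
randomization variables into the trajectory construction. -/
def ext (n : ℕ) (f : Fin n → ℝ) : ℕ → ℝ := fun j => if h : j < n then f ⟨j, h⟩ else 0

/-- The trajectory of a sequential experiment run by a non-anticipating allocation
mechanism `a` on the Gaussian two-arm instance `(μ1, μ0, σ1, σ0)`: unit `i` receives
treatment `Wᵢ = a i (history) (uᵢ)` (where `uᵢ` is exogenous uniform randomization,
so that `a` represents an arbitrary Markov kernel given the history), and the observed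
outcome is `Yᵢ = μ^{(Wᵢ)} + σ^{(Wᵢ)}·zᵢ` with `zᵢ` standard Gaussian. -/
noncomputable def traj (a : (i : ℕ) → (Fin i → Bool × ℝ) → ℝ → Bool)
    (μ1 μ0 σ1 σ0 : ℝ) (u z : ℕ → ℝ) : (i : ℕ) → Bool × ℝ := fun i =>
  Nat.strongRecOn i (fun i ih =>
    let w := a i (fun j : Fin i => ih j j.isLt) (u i)
    (w, if w then μ1 + σ1 * z i else μ0 + σ0 * z i))

/-- The canonical probability space carrying the exogenous randomness: `n` i.i.d.
uniform variables on `[0,1]` (for the allocation mechanism) and `n` i.i.d. standard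
Gaussians (for the outcomes). -/
noncomputable def Pbase (n : ℕ) : Measure ((Fin n → ℝ) × (Fin n → ℝ)) :=
  (Measure.pi fun _ : Fin n => volume.restrict (Set.Icc (0 : ℝ) 1)).prod
    (Measure.pi fun _ : Fin n => gaussianReal 0 1)

/-- The collected data `𝓕ₙ = (W₁, Y₁, …, Wₙ, Yₙ)` of the experiment. -/
noncomputable def data (n : ℕ) (a : (i : ℕ) → (Fin i → Bool × ℝ) → ℝ → Bool)
    (μ1 μ0 σ1 σ0 : ℝ) (ω : (Fin n → ℝ) × (Fin n → ℝ)) : Fin n → Bool × ℝ :=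
  fun i => traj a μ1 μ0 σ1 σ0 (ext n ω.1) (ext n ω.2) i

lemma lintegral_pi_snoc (n : ℕ) (ν : Measure ℝ) [SigmaFinite ν] {F : (Fin (n + 1) → ℝ) → ℝ≥0∞}
    (hF : Measurable F) :
    ∫⁻ x, F x ∂(Measure.pi fun _ : Fin (n + 1) => ν) =
      ∫⁻ x, ∫⁻ t, F (Fin.snoc x t) ∂ν ∂(Measure.pi fun _ : Fin n => ν) := by
  have h := (measurePreserving_piFinSuccAbove (fun _ : Fin (n + 1) => ν) (Fin.last n)).symm
  have hF' := hF.comp (MeasurableEquiv.piFinSuccAbove (fun _ : Fin (n + 1) => ℝ)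
    (Fin.last n)).symm.measurable
  rw [← h.lintegral_comp hF]
  refine (lintegral_prod_symm _ hF'.aemeasurable).trans ?_
  simp_rw [Function.comp_apply, MeasurableEquiv.piFinSuccAbove_symm_apply, Fin.insertNthEquiv,
    Equiv.coe_fn_mk, Fin.insertNth_last']

lemma measurable_snoc {α β : Type*} [MeasurableSpace α] [MeasurableSpace β] {n : ℕ}
    {f : α → Fin n → β} {g : α → β} (hf : Measurable f) (hg : Measurable g) :
    Measurable fun x => (Fin.snoc (f x) (g x) : Fin (n + 1) → β) := by
  refine measurable_pi_iff.2 fun i => ?_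
  refine Fin.lastCases ?_ (fun j => ?_) i
  · simpa using hg
  · simpa using measurable_pi_iff.1 hf j

instance (n : ℕ) : IsProbabilityMeasure (Pbase n) := by
  have : IsProbabilityMeasure (volume.restrict (Set.Icc (0 : ℝ) 1)) := ⟨by simp⟩
  unfold Pbase
  infer_instance

lemma lintegral_Pbase_succ (n : ℕ)
    {F : (Fin (n + 1) → ℝ) × (Fin (n + 1) → ℝ) → ℝ≥0∞} (hF : Measurable F) :
    ∫⁻ ω, F ω ∂(Pbase (n + 1)) =
      ∫⁻ ω, ∫⁻ u, ∫⁻ z, F (Fin.snoc ω.1 u, Fin.snoc ω.2 z)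
        ∂(gaussianReal 0 1) ∂(volume.restrict (Set.Icc (0 : ℝ) 1)) ∂(Pbase n) := by
  have hm : Measurable fun p : (((Fin n → ℝ) × (Fin n → ℝ)) × ℝ) × ℝ =>
      F (Fin.snoc p.1.1.1 p.1.2, Fin.snoc p.1.1.2 p.2) :=
    hF.comp ((measurable_snoc (by fun_prop) (by fun_prop)).prodMk
      (measurable_snoc (by fun_prop) (by fun_prop)))
  unfold Pbase
  rw [lintegral_prod _ hF.aemeasurable, lintegral_prod _ (by
      exact (hm.lintegral_prod_right').lintegral_prod_right'.aemeasurable),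
    lintegral_pi_snoc n _ hF.lintegral_prod_right']
  refine lintegral_congr fun u => ?_
  refine (lintegral_congr fun u' => lintegral_pi_snoc n _
    (hF.comp (measurable_const.prodMk measurable_id))).trans (lintegral_lintegral_swap ?_)
  exact (hm.comp (f := fun q : (ℝ × (Fin n → ℝ)) × ℝ => (((u, q.1.2), q.1.1), q.2))
    (by fun_prop)).lintegral_prod_right'.aemeasurable

/-- The observation `(W, Y)` of a unit with treatment `w` and standardized noise `z`. -/
noncomputable def outcome (μ1 μ0 σ1 σ0 : ℝ) (w : Bool) (z : ℝ) : Bool × ℝ :=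
  (w, if w then μ1 + σ1 * z else μ0 + σ0 * z)

lemma traj_eq (a : (i : ℕ) → (Fin i → Bool × ℝ) → ℝ → Bool) (μ1 μ0 σ1 σ0 : ℝ) (u z : ℕ → ℝ)
    (i : ℕ) : traj a μ1 μ0 σ1 σ0 u z i =
      outcome μ1 μ0 σ1 σ0 (a i (fun j : Fin i => traj a μ1 μ0 σ1 σ0 u z j) (u i)) (z i) := by
  unfold traj
  rw [Nat.strongRecOn_eq]
  rfl

lemma traj_congr (a : (i : ℕ) → (Fin i → Bool × ℝ) → ℝ → Bool) (μ1 μ0 σ1 σ0 : ℝ)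
    {u z u' z' : ℕ → ℝ} (i : ℕ) (hu : ∀ j ≤ i, u j = u' j) (hz : ∀ j ≤ i, z j = z' j) :
    traj a μ1 μ0 σ1 σ0 u z i = traj a μ1 μ0 σ1 σ0 u' z' i := by
  induction i using Nat.strong_induction_on with
  | _ i ih =>
    have h : ∀ j : Fin i, traj a μ1 μ0 σ1 σ0 u z j = traj a μ1 μ0 σ1 σ0 u' z' j := fun j =>
      ih j j.isLt (fun k hk => hu k (hk.trans j.isLt.le)) (fun k hk => hz k (hk.trans j.isLt.le))
    rw [traj_eq, traj_eq, hu i le_rfl, hz i le_rfl]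
    simp_rw [h]

lemma data_snoc (n : ℕ) (a : (i : ℕ) → (Fin i → Bool × ℝ) → ℝ → Bool) (μ1 μ0 σ1 σ0 : ℝ)
    (ω : (Fin n → ℝ) × (Fin n → ℝ)) (u z : ℝ) :
    data (n + 1) a μ1 μ0 σ1 σ0 (Fin.snoc ω.1 u, Fin.snoc ω.2 z) =
      Fin.snoc (data n a μ1 μ0 σ1 σ0 ω)
        (outcome μ1 μ0 σ1 σ0 (a n (data n a μ1 μ0 σ1 σ0 ω) u) z) := by
  have hext : ∀ (f : Fin n → ℝ) (t : ℝ) (j : ℕ), j < n →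
      ext (n + 1) (Fin.snoc f t) j = ext n f j := by
    intro f t j hj
    simp [ext, hj, Nat.lt_succ_of_lt hj, Fin.snoc]
  have hlast : ∀ (f : Fin n → ℝ) (t : ℝ), ext (n + 1) (Fin.snoc f t) n = t := by
    intro f t
    simp [ext, Fin.snoc]
  have hpast : ∀ i : Fin n,
      traj a μ1 μ0 σ1 σ0 (ext (n + 1) (Fin.snoc ω.1 u)) (ext (n + 1) (Fin.snoc ω.2 z)) i =
        traj a μ1 μ0 σ1 σ0 (ext n ω.1) (ext n ω.2) i := fun i =>
    traj_congr a μ1 μ0 σ1 σ0 i (fun j hj => hext _ _ _ (hj.trans_lt i.isLt))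
      (fun j hj => hext _ _ _ (hj.trans_lt i.isLt))
  funext i
  refine Fin.lastCases ?_ (fun j => ?_) i
  · simp only [Fin.snoc_last, data, Fin.val_last]
    rw [traj_eq]
    simp_rw [hpast, hlast]
    rfl
  · simpa [data] using hpast j

lemma measurable_outcome (μ1 μ0 σ1 σ0 : ℝ) :
    Measurable fun p : Bool × ℝ => outcome μ1 μ0 σ1 σ0 p.1 p.2 := by
  refine measurable_fst.prodMk (Measurable.ite ?_ (by fun_prop) (by fun_prop))
  exact measurable_fst (measurableSet_singleton true)

lemma measurable_data (n : ℕ) (a : (i : ℕ) → (Fin i → Bool × ℝ) → ℝ → Bool)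
    (ha : ∀ i, Measurable fun p : (Fin i → Bool × ℝ) × ℝ => a i p.1 p.2) (μ1 μ0 σ1 σ0 : ℝ) :
    Measurable (data n a μ1 μ0 σ1 σ0) := by
  induction n with
  | zero => exact measurable_of_subsingleton_codomain _
  | succ n ih =>
    have hi : Measurable fun ω : (Fin (n + 1) → ℝ) × (Fin (n + 1) → ℝ) =>
        data n a μ1 μ0 σ1 σ0 (Fin.init ω.1, Fin.init ω.2) :=
      ih.comp (by unfold Fin.init; fun_prop)
    have h := measurable_snoc hi ((measurable_outcome μ1 μ0 σ1 σ0).comp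
      (((ha n).comp (hi.prodMk ((measurable_pi_apply (Fin.last n)).comp measurable_fst))).prodMk
        ((measurable_pi_apply (Fin.last n)).comp measurable_snd)))
    convert h using 1
    funext ω
    have := data_snoc n a μ1 μ0 σ1 σ0 (Fin.init ω.1, Fin.init ω.2) (ω.1 (Fin.last n))
      (ω.2 (Fin.last n))
    simpa using this

/-- Density at `y` of `N(m, s²)` with respect to the standard Gaussian. -/
noncomputable def gaussianLik (m s y : ℝ) : ℝ :=
  s⁻¹ * Real.exp (y ^ 2 / 2 - (y - m) ^ 2 / (2 * s ^ 2))

lemma measurable_gaussianLik (s : ℝ) : Measurable fun p : ℝ × ℝ => gaussianLik p.1 s p.2 := by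
  unfold gaussianLik
  fun_prop

lemma gaussianLik_pos (m : ℝ) {s : ℝ} (hs : 0 < s) (y : ℝ) : 0 < gaussianLik m s y := by
  unfold gaussianLik
  positivity

lemma gaussianPDFReal_eq_mul_gaussianLik (m : ℝ) {s : ℝ} (hs : 0 < s) (y : ℝ) :
    gaussianPDFReal m (NNReal.mk (s ^ 2) (sq_nonneg s)) y =
      gaussianPDFReal 0 1 y * gaussianLik m s y := by
  have h2 : √(2 * Real.pi * s ^ 2) = √(2 * Real.pi) * s := by
    rw [Real.sqrt_mul (by positivity), Real.sqrt_sq hs.le]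
  simp only [gaussianPDFReal, gaussianLik, NNReal.coe_mk, NNReal.coe_one, mul_one, sub_zero, h2]
  rw [mul_inv, mul_mul_mul_comm, ← Real.exp_add]
  congr 2
  ring

lemma lintegral_affine_gaussianReal (m : ℝ) {s : ℝ} (hs : 0 < s) {F : ℝ → ℝ≥0∞}
    (hF : Measurable F) :
    ∫⁻ z, F (m + s * z) ∂(gaussianReal 0 1) =
      ∫⁻ y, F y * ENNReal.ofReal (gaussianLik m s y) ∂(gaussianReal 0 1) := by
  have hmap : (gaussianReal 0 1).map (fun z => m + s * z) =
      gaussianReal m (NNReal.mk (s ^ 2) (sq_nonneg s)) := by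
    have := Measure.map_map (μ := gaussianReal 0 1) (measurable_const_add m)
      (measurable_const_mul s)
    rw [gaussianReal_map_const_mul, gaussianReal_map_const_add] at this
    simpa [Function.comp_def] using this.symm
  have hs2 : NNReal.mk (s ^ 2) (sq_nonneg s) ≠ 0 := by
    intro h
    have := congrArg NNReal.toReal h
    simp at this
    exact hs.ne' this
  have hl : Measurable fun y => gaussianLik m s y :=
    (measurable_gaussianLik s).comp measurable_prodMk_left
  rw [← lintegral_map (f := F) (g := fun z => m + s * z) hF (by fun_prop), hmap,
    gaussianReal_of_var_ne_zero _ hs2, gaussianReal_of_var_ne_zero _ one_ne_zero,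
    lintegral_withDensity_eq_lintegral_mul _ (measurable_gaussianPDF _ _) hF,
    lintegral_withDensity_eq_lintegral_mul _ (measurable_gaussianPDF _ _)
      (g := fun y => F y * ENNReal.ofReal (gaussianLik m s y)) (hF.mul hl.ennreal_ofReal)]
  refine lintegral_congr fun y => ?_
  simp only [Pi.mul_apply, gaussianPDF]
  rw [gaussianPDFReal_eq_mul_gaussianLik m hs, ENNReal.ofReal_mul (gaussianPDFReal_nonneg _ _ _)]
  ring

/-- Likelihood ratio of one observation against the standard Gaussian instance. -/
noncomputable def unitLik (μ1 μ0 σ1 σ0 : ℝ) (p : Bool × ℝ) : ℝ :=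
  if p.1 then gaussianLik μ1 σ1 p.2 else gaussianLik μ0 σ0 p.2

lemma unitLik_pos (μ1 μ0 : ℝ) {σ1 σ0 : ℝ} (h1 : 0 < σ1) (h0 : 0 < σ0) (p : Bool × ℝ) :
    0 < unitLik μ1 μ0 σ1 σ0 p := by
  unfold unitLik
  split_ifs
  exacts [gaussianLik_pos _ h1 _, gaussianLik_pos _ h0 _]

lemma measurable_unitLik (σ1 σ0 : ℝ) :
    Measurable fun q : (ℝ × ℝ) × (Bool × ℝ) => unitLik q.1.1 q.1.2 σ1 σ0 q.2 := by
  unfold unitLik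
  refine Measurable.ite ?_ ?_ ?_
  · exact (measurable_fst.comp measurable_snd) (measurableSet_singleton true)
  · exact (measurable_gaussianLik σ1).comp
      (f := fun q : (ℝ × ℝ) × (Bool × ℝ) => (q.1.1, q.2.2)) (by fun_prop)
  · exact (measurable_gaussianLik σ0).comp
      (f := fun q : (ℝ × ℝ) × (Bool × ℝ) => (q.1.2, q.2.2)) (by fun_prop)

lemma lintegral_outcome {μ1 μ0 σ1 σ0 : ℝ} (h1 : 0 < σ1) (h0 : 0 < σ0) (w : Bool)
    {F : Bool × ℝ → ℝ≥0∞} (hF : Measurable F) :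
    ∫⁻ z, F (outcome μ1 μ0 σ1 σ0 w z) ∂(gaussianReal 0 1) =
      ∫⁻ z, F (outcome 0 0 1 1 w z) *
        ENNReal.ofReal (unitLik μ1 μ0 σ1 σ0 (outcome 0 0 1 1 w z)) ∂(gaussianReal 0 1) := by
  have hFw : Measurable fun y => F (w, y) := hF.comp measurable_prodMk_left
  cases w
  · simpa [outcome, unitLik] using lintegral_affine_gaussianReal μ0 h0 hFw
  · simpa [outcome, unitLik] using lintegral_affine_gaussianReal μ1 h1 hFw

/-- Likelihood ratio of the collected data against the standard Gaussian instance. -/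
noncomputable def dataLik {n : ℕ} (μ1 μ0 σ1 σ0 : ℝ) (x : Fin n → Bool × ℝ) : ℝ :=
  ∏ i, unitLik μ1 μ0 σ1 σ0 (x i)

lemma dataLik_pos {n : ℕ} (μ1 μ0 : ℝ) {σ1 σ0 : ℝ} (h1 : 0 < σ1) (h0 : 0 < σ0)
    (x : Fin n → Bool × ℝ) : 0 < dataLik μ1 μ0 σ1 σ0 x :=
  Finset.prod_pos fun _ _ => unitLik_pos _ _ h1 h0 _

lemma measurable_dataLik (n : ℕ) (σ1 σ0 : ℝ) :
    Measurable fun q : (ℝ × ℝ) × (Fin n → Bool × ℝ) => dataLik q.1.1 q.1.2 σ1 σ0 q.2 := by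
  unfold dataLik
  refine Finset.measurable_prod _ fun i _ => ?_
  exact (measurable_unitLik σ1 σ0).comp
    (f := fun q : (ℝ × ℝ) × (Fin n → Bool × ℝ) => (q.1, q.2 i)) (by fun_prop)

lemma lintegral_data (n : ℕ) (a : (i : ℕ) → (Fin i → Bool × ℝ) → ℝ → Bool)
    (ha : ∀ i, Measurable fun p : (Fin i → Bool × ℝ) × ℝ => a i p.1 p.2)
    {μ1 μ0 σ1 σ0 : ℝ} (h1 : 0 < σ1) (h0 : 0 < σ0)
    {F : (Fin n → Bool × ℝ) → ℝ≥0∞} (hF : Measurable F) :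
    ∫⁻ ω, F (data n a μ1 μ0 σ1 σ0 ω) ∂(Pbase n) =
      ∫⁻ ω, F (data n a 0 0 1 1 ω) *
        ENNReal.ofReal (dataLik μ1 μ0 σ1 σ0 (data n a 0 0 1 1 ω)) ∂(Pbase n) := by
  induction n with
  | zero =>
    refine lintegral_congr fun ω => ?_
    simp [dataLik, Subsingleton.elim (data 0 a μ1 μ0 σ1 σ0 ω) (data 0 a 0 0 1 1 ω)]
  | succ n ih =>
    have hL : Measurable fun x : Fin (n + 1) → Bool × ℝ => dataLik μ1 μ0 σ1 σ0 x :=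
      (measurable_dataLik (n + 1) σ1 σ0).comp
        (f := fun x : Fin (n + 1) → Bool × ℝ => ((μ1, μ0), x)) measurable_prodMk_left
    have hd := fun μ1 μ0 σ1 σ0 => measurable_data (n + 1) a ha μ1 μ0 σ1 σ0
    rw [lintegral_Pbase_succ n (F := fun ω => F (data (n + 1) a μ1 μ0 σ1 σ0 ω))
        (hF.comp (hd μ1 μ0 σ1 σ0)),
      lintegral_Pbase_succ n (F := fun ω => F (data (n + 1) a 0 0 1 1 ω) *
          ENNReal.ofReal (dataLik μ1 μ0 σ1 σ0 (data (n + 1) a 0 0 1 1 ω)))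
        ((hF.comp (hd 0 0 1 1)).mul (hL.comp (hd 0 0 1 1)).ennreal_ofReal)]
    simp only [data_snoc]
    have hG : Measurable fun h : Fin n → Bool × ℝ =>
        ∫⁻ u, ∫⁻ z, F (Fin.snoc h (outcome μ1 μ0 σ1 σ0 (a n h u) z))
          ∂(gaussianReal 0 1) ∂(volume.restrict (Set.Icc (0 : ℝ) 1)) := by
      refine Measurable.lintegral_prod_right' (f := fun q : (Fin n → Bool × ℝ) × ℝ =>
        ∫⁻ z, F (Fin.snoc q.1 (outcome μ1 μ0 σ1 σ0 (a n q.1 q.2) z)) ∂(gaussianReal 0 1)) ?_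
      refine Measurable.lintegral_prod_right' (f := fun q : ((Fin n → Bool × ℝ) × ℝ) × ℝ =>
        F (Fin.snoc q.1.1 (outcome μ1 μ0 σ1 σ0 (a n q.1.1 q.1.2) q.2))) ?_
      exact hF.comp (measurable_snoc (by fun_prop) ((measurable_outcome μ1 μ0 σ1 σ0).comp
        (((ha n).comp measurable_fst).prodMk measurable_snd)))
    rw [ih hG]
    refine lintegral_congr fun ω => ?_
    rw [← lintegral_mul_const' _ _ ENNReal.ofReal_ne_top]
    refine lintegral_congr fun u => ?_
    rw [lintegral_outcome h1 h0 _ (F := fun p => F (Fin.snoc (data n a 0 0 1 1 ω) p))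
        (hF.comp (measurable_snoc measurable_const measurable_id)),
      ← lintegral_mul_const' _ _ ENNReal.ofReal_ne_top]
    refine lintegral_congr fun z => ?_
    have hprod : ∀ (h : Fin n → Bool × ℝ) (p : Bool × ℝ),
        dataLik μ1 μ0 σ1 σ0 (Fin.snoc h p : Fin (n + 1) → Bool × ℝ) =
          unitLik μ1 μ0 σ1 σ0 p * dataLik μ1 μ0 σ1 σ0 h := by
      intro h p
      simp [dataLik, Fin.prod_univ_castSucc, mul_comm]
    rw [hprod, ENNReal.ofReal_mul (unitLik_pos _ _ h1 h0 _).le, mul_assoc]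

lemma lintegral_dataLik (n : ℕ) (a : (i : ℕ) → (Fin i → Bool × ℝ) → ℝ → Bool)
    (ha : ∀ i, Measurable fun p : (Fin i → Bool × ℝ) × ℝ => a i p.1 p.2)
    (μ1 μ0 : ℝ) {σ1 σ0 : ℝ} (h1 : 0 < σ1) (h0 : 0 < σ0) :
    ∫⁻ ω, ENNReal.ofReal (dataLik μ1 μ0 σ1 σ0 (data n a 0 0 1 1 ω)) ∂(Pbase n) = 1 := by
  simpa using
    (lintegral_data n a ha (μ1 := μ1) (μ0 := μ0) h1 h0 (F := fun _ => 1) measurable_const).symm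

/-- The number of units assigned to arm `w`. -/
def armCount {n : ℕ} (w : Bool) (x : Fin n → Bool × ℝ) : ℕ :=
  (Finset.univ.filter fun i => (x i).1 = w).card

lemma armCount_add {n : ℕ} (x : Fin n → Bool × ℝ) :
    armCount true x + armCount false x = n := by
  have h := Finset.card_filter_add_card_filter_not (s := (Finset.univ : Finset (Fin n)))
    (fun i => (x i).1 = true)
  simpa [armCount] using h

lemma gaussianLik_eq_mul_exp (m : ℝ) {s : ℝ} (hs : 0 < s) (y : ℝ) :
    gaussianLik m s y = s⁻¹ * Real.exp (y ^ 2 / 2 - y ^ 2 / (2 * s ^ 2)) *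
      Real.exp (y / s ^ 2 * m - 1 / s ^ 2 / 2 * m ^ 2) := by
  rw [gaussianLik, mul_assoc, ← Real.exp_add]
  congr 2
  field_simp
  ring

lemma exists_dataLik_eq {n : ℕ} {σ1 σ0 : ℝ} (h1 : 0 < σ1) (h0 : 0 < σ0)
    (x : Fin n → Bool × ℝ) :
    ∃ c b1 b0 : ℝ, 0 ≤ c ∧ ∀ μ1 μ0, dataLik μ1 μ0 σ1 σ0 x =
      c * Real.exp (b1 * μ1 - armCount true x / σ1 ^ 2 / 2 * μ1 ^ 2) *
        Real.exp (b0 * μ0 - armCount false x / σ0 ^ 2 / 2 * μ0 ^ 2) := by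
  unfold dataLik armCount
  induction (Finset.univ : Finset (Fin n)) using Finset.induction_on with
  | empty => exact ⟨1, 0, 0, zero_le_one, fun _ _ => by simp⟩
  | insert i s hi ih =>
    obtain ⟨c, b1, b0, hc, h⟩ := ih
    rcases hx : x i with ⟨w, y⟩
    cases w
    · refine ⟨σ0⁻¹ * Real.exp (y ^ 2 / 2 - y ^ 2 / (2 * σ0 ^ 2)) * c, b1, y / σ0 ^ 2 + b0,
        by positivity, fun μ1 μ0 => ?_⟩
      rw [Finset.prod_insert hi, h, Finset.filter_insert, Finset.filter_insert]
      simp only [hx, unitLik, Bool.false_eq_true, if_false, if_true]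
      rw [Finset.card_insert_of_notMem (by simp [hi]), gaussianLik_eq_mul_exp μ0 h0 y,
        show ∀ p q r s t : ℝ, p * q * (r * s * t) = p * r * s * (q * t) by intros; ring,
        ← Real.exp_add]
      congr 2
      push_cast
      ring
    · refine ⟨σ1⁻¹ * Real.exp (y ^ 2 / 2 - y ^ 2 / (2 * σ1 ^ 2)) * c, y / σ1 ^ 2 + b1, b0,
        by positivity, fun μ1 μ0 => ?_⟩
      rw [Finset.prod_insert hi, h, Finset.filter_insert, Finset.filter_insert]
      simp only [hx, unitLik, Bool.true_eq_false, if_false, if_true]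
      rw [Finset.card_insert_of_notMem (by simp [hi]), gaussianLik_eq_mul_exp μ1 h1 y,
        show ∀ p q r s t : ℝ, p * q * (r * s * t) = p * r * (q * s) * t by intros; ring,
        ← Real.exp_add]
      congr 3
      push_cast
      ring

lemma exists_lintegral_exp_quadratic_gaussianReal {V : NNReal} (hV : V ≠ 0) (b : ℝ) (k : NNReal) :
    ∃ (C : ℝ≥0∞) (m : ℝ), C ≠ ∞ ∧ ∀ f : ℝ → ℝ≥0∞, Measurable f →
      ∫⁻ μ, ENNReal.ofReal (Real.exp (b * μ - k / 2 * μ ^ 2)) * f μ ∂(gaussianReal 0 V) =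
        C * ∫⁻ μ, f μ ∂(gaussianReal m (k + V⁻¹)⁻¹) := by
  set v : NNReal := (k + V⁻¹)⁻¹ with hv
  have hVpos : (0 : ℝ) < V := by positivity
  have hv0 : v ≠ 0 := by positivity
  have hvpos : (0 : ℝ) < v := by positivity
  have hvr : (k : ℝ) + (V : ℝ)⁻¹ = (v : ℝ)⁻¹ := by simp [hv]
  refine ⟨ENNReal.ofReal (√(2 * Real.pi * v) / √(2 * Real.pi * V) * Real.exp (b ^ 2 * v / 2)),
    b * v, ENNReal.ofReal_ne_top, fun f hf => ?_⟩
  rw [gaussianReal_of_var_ne_zero _ hV, gaussianReal_of_var_ne_zero _ hv0,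
    lintegral_withDensity_eq_lintegral_mul _ (measurable_gaussianPDF _ _) hf,
    lintegral_withDensity_eq_lintegral_mul _ (measurable_gaussianPDF _ _)
      (g := fun μ => ENNReal.ofReal (Real.exp (b * μ - k / 2 * μ ^ 2)) * f μ) (by fun_prop),
    ← lintegral_const_mul' _ _ ENNReal.ofReal_ne_top]
  refine lintegral_congr fun μ => ?_
  simp only [Pi.mul_apply, gaussianPDF]
  rw [← mul_assoc, ← mul_assoc, ← ENNReal.ofReal_mul (gaussianPDFReal_nonneg _ _ _),
    ← ENNReal.ofReal_mul (by positivity)]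
  congr 2
  have hk : (k : ℝ) = (v : ℝ)⁻¹ - (V : ℝ)⁻¹ := by linarith
  have hsv : √(2 * Real.pi * v) ≠ 0 := by positivity
  simp only [gaussianPDFReal]
  rw [mul_assoc, ← Real.exp_add, show ∀ p q r s t : ℝ, p / q * r * (s * t) = (p * s) * q⁻¹ * (r * t)
    by intros; ring, mul_inv_cancel₀ hsv, one_mul, ← Real.exp_add]
  congr 2
  rw [hk]
  field_simp
  ring

lemma lintegral_sq_sub_gaussianReal (t m : ℝ) (v : NNReal) :
    ∫⁻ μ, ENNReal.ofReal ((t - μ) ^ 2) ∂(gaussianReal m v) = ENNReal.ofReal ((t - m) ^ 2 + v) := by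
  have hL : MemLp (fun x : ℝ => x) 2 (gaussianReal m v) := memLp_id_gaussianReal 2
  have hi : Integrable (fun x : ℝ => x) (gaussianReal m v) := hL.integrable (by norm_num)
  have hi2 : Integrable (fun x : ℝ => x ^ 2) (gaussianReal m v) := hL.integrable_sq
  have hLt : MemLp (fun x : ℝ => t - x) 2 (gaussianReal m v) := (memLp_const t).sub hL
  rw [← ofReal_integral_eq_lintegral_ofReal hLt.integrable_sq (ae_of_all _ fun _ => sq_nonneg _)]
  have hvar := variance_eq_sub hLt
  have hvar' : Var[fun x : ℝ => t - x; gaussianReal m v] = v := by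
    rw [variance_const_sub hL.aestronglyMeasurable, variance_fun_id_gaussianReal]
  have hmean : ∫ x, (t - x) ∂(gaussianReal m v) = t - m := by
    rw [integral_sub (integrable_const t) hi, integral_id_gaussianReal]
    simp
  rw [hvar', hmean] at hvar
  congr 1
  simp only [Pi.pow_apply] at hvar
  linarith

lemma ofReal_add_le_lintegral_sq_sub_sub (t m1 m0 : ℝ) (v1 v0 : NNReal) :
    ENNReal.ofReal (v1 + v0) ≤ ∫⁻ μ1, ∫⁻ μ0, ENNReal.ofReal ((t - (μ1 - μ0)) ^ 2)
      ∂(gaussianReal m0 v0) ∂(gaussianReal m1 v1) := by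
  have h : ∀ μ1, ∫⁻ μ0, ENNReal.ofReal ((t - (μ1 - μ0)) ^ 2) ∂(gaussianReal m0 v0) =
      ENNReal.ofReal ((t + m0 - μ1) ^ 2) + ENNReal.ofReal v0 := by
    intro μ1
    rw [← ENNReal.ofReal_add (sq_nonneg _) v0.coe_nonneg]
    rw [show (t + m0 - μ1) ^ 2 = (μ1 - t - m0) ^ 2 by ring, ← lintegral_sq_sub_gaussianReal]
    refine lintegral_congr fun μ0 => ?_
    congr 1
    ring
  simp_rw [h]
  rw [lintegral_add_right _ measurable_const, lintegral_sq_sub_gaussianReal, lintegral_const,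
    measure_univ, mul_one, ENNReal.ofReal_add v1.coe_nonneg v0.coe_nonneg]
  gcongr
  nlinarith [sq_nonneg (t + m0 - m1)]

/-- Variance of the difference of means of two independent posteriors, each of precision the sum
of the data precision `Nᵢ / σᵢ²` and the prior precision `V⁻¹`. -/
noncomputable def posteriorVar (V : NNReal) (σ1 σ0 : ℝ) {n : ℕ} (x : Fin n → Bool × ℝ) : ℝ :=
  (armCount true x / σ1 ^ 2 + (V : ℝ)⁻¹)⁻¹ + (armCount false x / σ0 ^ 2 + (V : ℝ)⁻¹)⁻¹

lemma posteriorVar_nonneg (V : NNReal) (σ1 σ0 : ℝ) {n : ℕ} (x : Fin n → Bool × ℝ) :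
    0 ≤ posteriorVar V σ1 σ0 x := by
  unfold posteriorVar
  positivity

lemma exists_lintegral_dataLik_mul {V : NNReal} (hV : V ≠ 0) {n : ℕ} {σ1 σ0 : ℝ} (h1 : 0 < σ1)
    (h0 : 0 < σ0) (x : Fin n → Bool × ℝ) :
    ∃ (C : ℝ≥0∞) (m1 m0 : ℝ) (v1 v0 : NNReal), (v1 + v0 : ℝ) = posteriorVar V σ1 σ0 x ∧
      ∀ f : ℝ × ℝ → ℝ≥0∞, Measurable f →
        ∫⁻ p, ENNReal.ofReal (dataLik p.1 p.2 σ1 σ0 x) * f p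
            ∂((gaussianReal 0 V).prod (gaussianReal 0 V)) =
          C * ∫⁻ μ1, ∫⁻ μ0, f (μ1, μ0) ∂(gaussianReal m0 v0) ∂(gaussianReal m1 v1) := by
  obtain ⟨c, b1, b0, hc, h⟩ := exists_dataLik_eq h1 h0 x
  obtain ⟨k1, hk1⟩ : ∃ k : NNReal, (k : ℝ) = armCount true x / σ1 ^ 2 :=
    ⟨NNReal.mk _ (by positivity), rfl⟩
  obtain ⟨k0, hk0⟩ : ∃ k : NNReal, (k : ℝ) = armCount false x / σ0 ^ 2 :=
    ⟨NNReal.mk _ (by positivity), rfl⟩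
  obtain ⟨C1, m1, hC1, H1⟩ := exists_lintegral_exp_quadratic_gaussianReal hV b1 k1
  obtain ⟨C0, m0, hC0, H0⟩ := exists_lintegral_exp_quadratic_gaussianReal hV b0 k0
  refine ⟨ENNReal.ofReal c * C0 * C1, m1, m0, (k1 + V⁻¹)⁻¹, (k0 + V⁻¹)⁻¹, ?_, fun f hf => ?_⟩
  · simp [posteriorVar, hk1, hk0]
  have hL : Measurable fun p : ℝ × ℝ => dataLik p.1 p.2 σ1 σ0 x :=
    (measurable_dataLik n σ1 σ0).comp (f := fun p : ℝ × ℝ => (p, x)) measurable_prodMk_right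
  rw [lintegral_prod (fun p => ENNReal.ofReal (dataLik p.1 p.2 σ1 σ0 x) * f p)
    (hL.ennreal_ofReal.mul hf).aemeasurable, mul_assoc, ← H1 _
    (hf.lintegral_prod_right'), ← lintegral_const_mul' _ _
      (ENNReal.mul_ne_top ENNReal.ofReal_ne_top hC0)]
  refine lintegral_congr fun μ1 => ?_
  rw [mul_left_comm, mul_assoc, ← H0 (fun μ0 => f (μ1, μ0)) (hf.comp measurable_prodMk_left), ← mul_assoc,
    ← ENNReal.ofReal_mul (Real.exp_nonneg _), ← lintegral_const_mul' _ _ ENNReal.ofReal_ne_top]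
  refine lintegral_congr fun μ0 => ?_
  rw [h, hk1, hk0, ← mul_assoc, ← ENNReal.ofReal_mul (by positivity), mul_comm c]

lemma lintegral_posteriorVar_mul_le {V : NNReal} (hV : V ≠ 0) {n : ℕ} {σ1 σ0 : ℝ} (h1 : 0 < σ1)
    (h0 : 0 < σ0) (x : Fin n → Bool × ℝ) (t : ℝ) :
    ∫⁻ p, ENNReal.ofReal (posteriorVar V σ1 σ0 x * dataLik p.1 p.2 σ1 σ0 x)
        ∂((gaussianReal 0 V).prod (gaussianReal 0 V)) ≤
      ∫⁻ p, ENNReal.ofReal (dataLik p.1 p.2 σ1 σ0 x) * ENNReal.ofReal ((t - (p.1 - p.2)) ^ 2)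
        ∂((gaussianReal 0 V).prod (gaussianReal 0 V)) := by
  obtain ⟨C, m1, m0, v1, v0, hv, H⟩ := exists_lintegral_dataLik_mul hV h1 h0 x
  have hconst := H (fun _ => ENNReal.ofReal (posteriorVar V σ1 σ0 x)) measurable_const
  rw [H _ (by fun_prop)]
  simp_rw [mul_comm (posteriorVar V σ1 σ0 x),
    ENNReal.ofReal_mul (dataLik_pos _ _ h1 h0 x).le]
  rw [hconst]
  refine mul_le_mul' le_rfl ?_
  simpa [hv] using ofReal_add_le_lintegral_sq_sub_sub t m1 m0 v1 v0

lemma gaussianLik_one_mul_gaussianLik (m : ℝ) {r : ℝ} (hr : 0 < r) (y : ℝ) :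
    gaussianLik m 1 y * gaussianLik m r y =
      2 * r / (1 + r ^ 2) * gaussianLik m √(2 * r ^ 2 / (1 + r ^ 2)) y ^ 2 := by
  have hsq : √(2 * r ^ 2 / (1 + r ^ 2)) ^ 2 = 2 * r ^ 2 / (1 + r ^ 2) :=
    Real.sq_sqrt (by positivity)
  simp only [gaussianLik, mul_pow, inv_pow, hsq, ← Real.exp_nat_mul]
  rw [mul_mul_mul_comm, ← Real.exp_add, ← mul_assoc]
  congr 1
  · field_simp
  · congr 1
    push_cast
    field_simp
    ring

lemma dataLik_mul_dataLik_swap {n : ℕ} (μ1 μ0 : ℝ) {r : ℝ} (hr : 0 < r)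
    (x : Fin n → Bool × ℝ) :
    dataLik μ1 μ0 1 r x * dataLik μ1 μ0 r 1 x = (2 * r / (1 + r ^ 2)) ^ n *
      dataLik μ1 μ0 √(2 * r ^ 2 / (1 + r ^ 2)) √(2 * r ^ 2 / (1 + r ^ 2)) x ^ 2 := by
  have h : ∀ i, unitLik μ1 μ0 1 r (x i) * unitLik μ1 μ0 r 1 (x i) = 2 * r / (1 + r ^ 2) *
      unitLik μ1 μ0 √(2 * r ^ 2 / (1 + r ^ 2)) √(2 * r ^ 2 / (1 + r ^ 2)) (x i) ^ 2 := by
    intro i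
    unfold unitLik
    split_ifs
    · exact gaussianLik_one_mul_gaussianLik _ hr _
    · rw [mul_comm]
      exact gaussianLik_one_mul_gaussianLik _ hr _
  simp_rw [dataLik, ← Finset.prod_mul_distrib, h, Finset.prod_mul_distrib, Finset.prod_pow,
    Finset.prod_const, Finset.card_univ, Fintype.card_fin]

lemma le_mul_div_add_of_mul_eq {f g h q : ℝ} (hf : 0 < f) (hg : 0 < g) (hq : 0 ≤ q)
    (hfg : f * g = q * h ^ 2) : q * h - q / 4 * (f + g) ≤ f * g / (f + g) := by
  rw [le_div_iff₀ (by positivity), hfg]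
  nlinarith [mul_nonneg hq (sq_nonneg (h - (f + g) / 2))]

/-- The optimal allocation differs between the instances with standard deviations `(1, r)` and
`(r, 1)`, so that no allocation `(x, y)` is optimal for both. -/
lemma two_point_allocation_le {r x y f g h q : ℝ} (hx : 0 < x)
    (hy : 0 < y) (hf : 0 < f) (hg : 0 < g) (hq : 0 ≤ q) (hfg : f * g = q * h ^ 2) :
    ((1 + r) ^ 2 / (x + y) - (1 - r) ^ 2 / (x + y) * q) * (f + g) +
        4 * (1 - r) ^ 2 / (x + y) * q * h ≤
      (1 / x + r ^ 2 / y) * f + (r ^ 2 / x + 1 / y) * g := by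
  have hm : 0 < x + y := by positivity
  have e1 : 1 / x + r ^ 2 / y = (1 + r) ^ 2 / (x + y) + (y - r * x) ^ 2 / (x * y * (x + y)) := by
    field_simp
    ring
  have e2 : r ^ 2 / x + 1 / y = (1 + r) ^ 2 / (x + y) + (r * y - x) ^ 2 / (x * y * (x + y)) := by
    field_simp
    ring
  have hcs : f * g / (f + g) * ((1 - r) ^ 2 * (x + y) ^ 2) ≤
      f * (y - r * x) ^ 2 + g * (r * y - x) ^ 2 := by
    rw [div_mul_eq_mul_div, div_le_iff₀ (by positivity)]
    nlinarith [sq_nonneg (f * (y - r * x) + g * (r * y - x))]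
  have h4 : 4 / (x + y) ≤ (x + y) ^ 2 / (x * y * (x + y)) := by
    rw [div_le_div_iff₀ hm (by positivity)]
    nlinarith [mul_nonneg (mul_nonneg hm.le hm.le) (sq_nonneg (x - y)),
      mul_nonneg hm.le (sq_nonneg (x - y))]
  have hkey : (q * h - q / 4 * (f + g)) * ((1 - r) ^ 2 * (4 / (x + y))) ≤
      (f * (y - r * x) ^ 2 + g * (r * y - x) ^ 2) / (x * y * (x + y)) := by
    calc _ ≤ f * g / (f + g) * ((1 - r) ^ 2 * (4 / (x + y))) := by
          gcongr
          exact le_mul_div_add_of_mul_eq hf hg hq hfg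
      _ ≤ f * g / (f + g) * ((1 - r) ^ 2 * ((x + y) ^ 2 / (x * y * (x + y)))) := by gcongr
      _ = f * g / (f + g) * ((1 - r) ^ 2 * (x + y) ^ 2) / (x * y * (x + y)) := by ring
      _ ≤ _ := by gcongr
  rw [e1, e2]
  calc _ = (1 + r) ^ 2 / (x + y) * (f + g) +
        (q * h - q / 4 * (f + g)) * ((1 - r) ^ 2 * (4 / (x + y))) := by ring
    _ ≤ (1 + r) ^ 2 / (x + y) * (f + g) +
        (f * (y - r * x) ^ 2 + g * (r * y - x) ^ 2) / (x * y * (x + y)) := by gcongr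
    _ = _ := by ring

lemma le_posteriorVar {V : NNReal} (hV : V ≠ 0) {n : ℕ} {σ1 σ0 : ℝ} (h1 : 0 < σ1)
    (h1' : σ1 ≤ 1) (h0 : 0 < σ0) (h0' : σ0 ≤ 1) (x : Fin n → Bool × ℝ) :
    σ1 ^ 2 / (armCount true x + (V : ℝ)⁻¹) + σ0 ^ 2 / (armCount false x + (V : ℝ)⁻¹) ≤
      posteriorVar V σ1 σ0 x := by
  have hVpos : (0 : ℝ) < (V : ℝ)⁻¹ := by positivity
  have key : ∀ (N : ℕ) {s : ℝ}, 0 < s → s ≤ 1 →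
      s ^ 2 / (N + (V : ℝ)⁻¹) ≤ (N / s ^ 2 + (V : ℝ)⁻¹)⁻¹ := by
    intro N s hs hs'
    have hs2 : s ^ 2 ≤ 1 := pow_le_one₀ hs.le hs'
    rw [div_le_iff₀ (by positivity), inv_mul_eq_div, le_div_iff₀ (by positivity), mul_add,
      mul_div_cancel₀ _ (by positivity)]
    nlinarith
  exact add_le_add (key _ h1 h1') (key _ h0 h0')

lemma measurable_dataLik_data (n : ℕ) (a : (i : ℕ) → (Fin i → Bool × ℝ) → ℝ → Bool)
    (ha : ∀ i, Measurable fun p : (Fin i → Bool × ℝ) × ℝ => a i p.1 p.2) (σ1 σ0 : ℝ) :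
    Measurable fun q : (ℝ × ℝ) × ((Fin n → ℝ) × (Fin n → ℝ)) =>
      dataLik q.1.1 q.1.2 σ1 σ0 (data n a 0 0 1 1 q.2) :=
  (measurable_dataLik n σ1 σ0).comp
    (f := fun q : (ℝ × ℝ) × ((Fin n → ℝ) × (Fin n → ℝ)) => (q.1, data n a 0 0 1 1 q.2))
    (measurable_fst.prodMk ((measurable_data n a ha 0 0 1 1).comp measurable_snd))

lemma measurable_weighted_loss (n : ℕ) (a : (i : ℕ) → (Fin i → Bool × ℝ) → ℝ → Bool)
    (ha : ∀ i, Measurable fun p : (Fin i → Bool × ℝ) × ℝ => a i p.1 p.2)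
    {T : (Fin n → Bool × ℝ) → ℝ} (hT : Measurable T) (σ1 σ0 : ℝ) :
    Measurable fun q : (ℝ × ℝ) × ((Fin n → ℝ) × (Fin n → ℝ)) =>
      ENNReal.ofReal (dataLik q.1.1 q.1.2 σ1 σ0 (data n a 0 0 1 1 q.2)) *
        ENNReal.ofReal ((T (data n a 0 0 1 1 q.2) - (q.1.1 - q.1.2)) ^ 2) := by
  have h : Measurable fun q : (ℝ × ℝ) × ((Fin n → ℝ) × (Fin n → ℝ)) =>
      T (data n a 0 0 1 1 q.2) := (hT.comp (measurable_data n a ha 0 0 1 1)).comp measurable_snd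
  exact (measurable_dataLik_data n a ha σ1 σ0).ennreal_ofReal.mul
    ((h.sub (by fun_prop)).pow_const 2).ennreal_ofReal

lemma lintegral_risk_eq (n : ℕ) (a : (i : ℕ) → (Fin i → Bool × ℝ) → ℝ → Bool)
    (ha : ∀ i, Measurable fun p : (Fin i → Bool × ℝ) × ℝ => a i p.1 p.2)
    {T : (Fin n → Bool × ℝ) → ℝ} (hT : Measurable T) {σ1 σ0 : ℝ} (h1 : 0 < σ1) (h0 : 0 < σ0)
    (P : Measure (ℝ × ℝ)) [SFinite P] :
    ∫⁻ p, ∫⁻ ω, ENNReal.ofReal ((T (data n a p.1 p.2 σ1 σ0 ω) - (p.1 - p.2)) ^ 2) ∂(Pbase n) ∂P =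
      ∫⁻ ω, ∫⁻ p, ENNReal.ofReal (dataLik p.1 p.2 σ1 σ0 (data n a 0 0 1 1 ω)) *
        ENNReal.ofReal ((T (data n a 0 0 1 1 ω) - (p.1 - p.2)) ^ 2) ∂P ∂(Pbase n) := by
  refine (lintegral_congr fun p => ?_).trans (lintegral_lintegral_swap
    (f := fun (p : ℝ × ℝ) ω => ENNReal.ofReal (dataLik p.1 p.2 σ1 σ0 (data n a 0 0 1 1 ω)) *
      ENNReal.ofReal ((T (data n a 0 0 1 1 ω) - (p.1 - p.2)) ^ 2))
    (measurable_weighted_loss n a ha hT σ1 σ0).aemeasurable)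
  rw [lintegral_data n a ha h1 h0
    (F := fun x => ENNReal.ofReal ((T x - (p.1 - p.2)) ^ 2)) (by fun_prop)]
  simp_rw [mul_comm]

lemma lintegral_lintegral_dataLik (n : ℕ) (a : (i : ℕ) → (Fin i → Bool × ℝ) → ℝ → Bool)
    (ha : ∀ i, Measurable fun p : (Fin i → Bool × ℝ) × ℝ => a i p.1 p.2)
    {σ1 σ0 : ℝ} (h1 : 0 < σ1) (h0 : 0 < σ0) (P : Measure (ℝ × ℝ)) [IsProbabilityMeasure P] :
    ∫⁻ ω, ∫⁻ p, ENNReal.ofReal (dataLik p.1 p.2 σ1 σ0 (data n a 0 0 1 1 ω)) ∂P ∂(Pbase n) = 1 := by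
  rw [← lintegral_lintegral_swap
    (measurable_dataLik_data n a ha σ1 σ0).ennreal_ofReal.aemeasurable]
  simp_rw [lintegral_dataLik n a ha _ _ h1 h0]
  simp

/-- Lower bound on the sum of the Bayes risks of the instances with standard deviations `(1, r)`
and `(r, 1)` under a common Gaussian prior on the arm means. -/
lemma le_bayes_risk_add_bayes_risk (n : ℕ) (a : (i : ℕ) → (Fin i → Bool × ℝ) → ℝ → Bool)
    (ha : ∀ i, Measurable fun p : (Fin i → Bool × ℝ) × ℝ => a i p.1 p.2)
    {T : (Fin n → Bool × ℝ) → ℝ} (hT : Measurable T) {V : NNReal} (hV : V ≠ 0)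
    {r : ℝ} (hr : 0 < r) (hr' : r ≤ 1) :
    ENNReal.ofReal ((2 * (1 + r) ^ 2 + 2 * (1 - r) ^ 2 * (2 * r / (1 + r ^ 2)) ^ n) /
        (n + 2 * (V : ℝ)⁻¹)) ≤
      ∫⁻ p, ∫⁻ ω, ENNReal.ofReal ((T (data n a p.1 p.2 1 r ω) - (p.1 - p.2)) ^ 2) ∂(Pbase n)
          ∂((gaussianReal 0 V).prod (gaussianReal 0 V)) +
        ∫⁻ p, ∫⁻ ω, ENNReal.ofReal ((T (data n a p.1 p.2 r 1 ω) - (p.1 - p.2)) ^ 2) ∂(Pbase n)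
          ∂((gaussianReal 0 V).prod (gaussianReal 0 V)) := by
  set P := (gaussianReal 0 V).prod (gaussianReal 0 V) with hP
  have hVpos : (0 : ℝ) < (V : ℝ)⁻¹ := by positivity
  set m : ℝ := n + 2 * (V : ℝ)⁻¹ with hm
  have hmpos : 0 < m := by positivity
  set q : ℝ := (2 * r / (1 + r ^ 2)) ^ n with hq
  have hq0 : 0 ≤ q := by positivity
  have hq1 : q ≤ 1 := by
    refine pow_le_one₀ (by positivity) ?_
    rw [div_le_one (by positivity)]
    nlinarith [sq_nonneg (1 - r)]
  set c : ℝ := √(2 * r ^ 2 / (1 + r ^ 2)) with hc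
  have hcpos : 0 < c := Real.sqrt_pos.2 (by positivity)
  set k : ℝ := (1 + r) ^ 2 / m - (1 - r) ^ 2 / m * q with hk
  have hk0 : 0 ≤ k := by
    rw [hk, div_mul_eq_mul_div, ← sub_div]
    refine div_nonneg ?_ hmpos.le
    nlinarith [mul_nonneg (sq_nonneg (1 - r)) (sub_nonneg.2 hq1)]
  set d : ℝ := 4 * (1 - r) ^ 2 / m * q with hd
  have hd0 : 0 ≤ d := by positivity
  have hLm : ∀ (s t : ℝ) (x : Fin n → Bool × ℝ), Measurable fun p : ℝ × ℝ =>
      dataLik p.1 p.2 s t x := fun s t x =>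
    (measurable_dataLik n s t).comp (f := fun p : ℝ × ℝ => (p, x)) measurable_prodMk_right
  have hpoint : ∀ (x : Fin n → Bool × ℝ) (p : ℝ × ℝ),
      k * dataLik p.1 p.2 1 r x + (k * dataLik p.1 p.2 r 1 x + d * dataLik p.1 p.2 c c x) ≤
        posteriorVar V 1 r x * dataLik p.1 p.2 1 r x +
          posteriorVar V r 1 x * dataLik p.1 p.2 r 1 x := by
    intro x p
    have hf := dataLik_pos p.1 p.2 one_pos hr x
    have hg := dataLik_pos p.1 p.2 hr one_pos x
    have hsum : (armCount true x + (V : ℝ)⁻¹) + (armCount false x + (V : ℝ)⁻¹) = m := by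
      have : (armCount true x : ℝ) + armCount false x = n := by exact_mod_cast armCount_add x
      rw [hm]
      linarith
    have h := two_point_allocation_le (r := r)
      (x := armCount true x + (V : ℝ)⁻¹) (y := armCount false x + (V : ℝ)⁻¹)
      (by positivity) (by positivity) hf hg hq0 (dataLik_mul_dataLik_swap p.1 p.2 hr x)
    rw [hsum] at h
    have hA := le_posteriorVar hV one_pos le_rfl hr hr' x
    have hB := le_posteriorVar hV hr hr' one_pos le_rfl x
    rw [one_pow] at hA hB
    linarith [mul_le_mul_of_nonneg_right hA hf.le, mul_le_mul_of_nonneg_right hB hg.le]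
  have hinner : ∀ ω, ENNReal.ofReal k *
        ∫⁻ p, ENNReal.ofReal (dataLik p.1 p.2 1 r (data n a 0 0 1 1 ω)) ∂P +
      (ENNReal.ofReal k *
        ∫⁻ p, ENNReal.ofReal (dataLik p.1 p.2 r 1 (data n a 0 0 1 1 ω)) ∂P +
      ENNReal.ofReal d *
        ∫⁻ p, ENNReal.ofReal (dataLik p.1 p.2 c c (data n a 0 0 1 1 ω)) ∂P) ≤
      ∫⁻ p, ENNReal.ofReal (dataLik p.1 p.2 1 r (data n a 0 0 1 1 ω)) *
          ENNReal.ofReal ((T (data n a 0 0 1 1 ω) - (p.1 - p.2)) ^ 2) ∂P +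
        ∫⁻ p, ENNReal.ofReal (dataLik p.1 p.2 r 1 (data n a 0 0 1 1 ω)) *
          ENNReal.ofReal ((T (data n a 0 0 1 1 ω) - (p.1 - p.2)) ^ 2) ∂P := by
    intro ω
    refine le_trans ?_ (add_le_add
      (lintegral_posteriorVar_mul_le hV one_pos hr (data n a 0 0 1 1 ω) _)
      (lintegral_posteriorVar_mul_le hV hr one_pos (data n a 0 0 1 1 ω) _))
    generalize data n a 0 0 1 1 ω = x
    rw [← lintegral_add_left ((hLm 1 r x).const_mul _).ennreal_ofReal,
      ← lintegral_const_mul' _ _ ENNReal.ofReal_ne_top,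
      ← lintegral_const_mul' _ _ ENNReal.ofReal_ne_top,
      ← lintegral_const_mul' _ _ ENNReal.ofReal_ne_top,
      ← lintegral_add_left ((hLm r 1 x).ennreal_ofReal.const_mul _),
      ← lintegral_add_left ((hLm 1 r x).ennreal_ofReal.const_mul _)]
    refine lintegral_mono fun p => ?_
    have hf := dataLik_pos p.1 p.2 one_pos hr x
    have hg := dataLik_pos p.1 p.2 hr one_pos x
    have hh := dataLik_pos p.1 p.2 hcpos hcpos x
    have hvA := posteriorVar_nonneg V 1 r x
    have hvB := posteriorVar_nonneg V r 1 x
    rw [← ENNReal.ofReal_mul hk0, ← ENNReal.ofReal_mul hk0, ← ENNReal.ofReal_mul hd0,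
      ← ENNReal.ofReal_add (by positivity) (by positivity),
      ← ENNReal.ofReal_add (by positivity) (by positivity),
      ← ENNReal.ofReal_add (by positivity) (by positivity)]
    exact ENNReal.ofReal_le_ofReal (hpoint x p)
  have hmeas : ∀ s t : ℝ, Measurable fun ω =>
      ∫⁻ p, ENNReal.ofReal (dataLik p.1 p.2 s t (data n a 0 0 1 1 ω)) ∂P := fun s t =>
    (measurable_dataLik_data n a ha s t).ennreal_ofReal.lintegral_prod_left'
  rw [lintegral_risk_eq n a ha hT one_pos hr, lintegral_risk_eq n a ha hT hr one_pos,
    ← lintegral_add_left (measurable_weighted_loss n a ha hT 1 r).lintegral_prod_left']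
  refine le_trans (le_of_eq ?_) (lintegral_mono hinner)
  rw [lintegral_add_left ((hmeas 1 r).const_mul _), lintegral_add_left ((hmeas r 1).const_mul _),
    lintegral_const_mul' _ _ ENNReal.ofReal_ne_top, lintegral_const_mul' _ _ ENNReal.ofReal_ne_top,
    lintegral_const_mul' _ _ ENNReal.ofReal_ne_top,
    lintegral_lintegral_dataLik n a ha one_pos hr, lintegral_lintegral_dataLik n a ha hr one_pos,
    lintegral_lintegral_dataLik n a ha hcpos hcpos, mul_one, mul_one,
    ← ENNReal.ofReal_add hk0 hd0, ← ENNReal.ofReal_add hk0 (by positivity)]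
  congr 1
  rw [hk, hd]
  ring

lemma three_quarters_le_affinity_pow {n : ℕ} {r : ℝ}
    (hr : 0 < r) (h : n * (1 - r) ^ 2 = 1 / 4) (hr' : (1 - r) ^ 2 ≤ 1) :
    3 / 4 ≤ (2 * r / (1 + r ^ 2)) ^ n := by
  have h1 : 1 - (1 - r) ^ 2 ≤ 2 * r / (1 + r ^ 2) := by
    rw [le_div_iff₀ (by positivity)]
    nlinarith [mul_nonneg (sq_nonneg (1 - r)) (sq_nonneg r)]
  have h2 := one_add_mul_le_pow (a := -(1 - r) ^ 2) (by linarith) n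
  calc (3 / 4 : ℝ) = 1 + n * (-(1 - r) ^ 2) := by linarith
    _ ≤ (1 + -(1 - r) ^ 2) ^ n := h2
    _ ≤ _ := pow_le_pow_left₀ (by linarith) (by linarith) n


lemma two_mul_risk_bound_lt {N r q : ℝ} (hN : 1 ≤ N) (hr0 : 0 < r) (hr1 : r ≤ 1)
    (h : N * (1 - r) ^ 2 = 1 / 4) (hq : 3 / 4 ≤ q) :
    2 * ((1 + r) ^ 2 / N + (1 + r) ^ 2 / (1000 * N ^ 2)) <
      (2 * (1 + r) ^ 2 + 2 * (1 - r) ^ 2 * q) / (N + 2 * (1 / 100)) := by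
  have hN0 : 0 < N := by linarith
  rw [lt_div_iff₀ (by positivity)]
  have hexp : 2 * ((1 + r) ^ 2 / N + (1 + r) ^ 2 / (1000 * N ^ 2)) * (N + 2 * (1 / 100)) =
      2 * (1 + r) ^ 2 + 2 * (1 + r) ^ 2 * (1 / 1000 + 1 / 50 + 1 / (50000 * N)) / N := by
    field_simp
    ring
  have hinv : 1 / (50000 * N) ≤ 1 / 50000 := by
    gcongr
    linarith
  have hs4 : (1 + r) ^ 2 ≤ 4 := by nlinarith
  have hr2 : (1 - r) ^ 2 = 1 / 4 / N := by
    rw [eq_div_iff hN0.ne', mul_comm, h]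
  have hlow : 2 * (1 / 4 / N) * (3 / 4) ≤ 2 * (1 - r) ^ 2 * q := by
    rw [hr2]
    gcongr
  have hhigh : 2 * (1 + r) ^ 2 * (1 / 1000 + 1 / 50 + 1 / (50000 * N)) / N ≤
      2 * 4 * (1 / 1000 + 1 / 50 + 1 / 50000) / N := by
    gcongr
  have hlt : 2 * 4 * (1 / 1000 + 1 / 50 + 1 / 50000) / N < 2 * (1 / 4 / N) * (3 / 4) := by
    rw [show 2 * (1 / 4 / N) * (3 / 4) = (3 / 8) / N by ring]
    gcongr
    norm_num
  linarith

lemma exists_near_one_sd {N : ℝ} (hN : 1 ≤ N) :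
    ∃ r : ℝ, 0 < r ∧ r ≤ 1 ∧ N * (1 - r) ^ 2 = 1 / 4 := by
  have hN0 : 0 < N := by linarith
  have hsqrt : 1 ≤ √N := Real.one_le_sqrt.2 hN
  have hle : 1 / (2 * √N) ≤ 1 / 2 := by
    gcongr
    linarith
  have hpos : 0 < 1 / (2 * √N) := by positivity
  refine ⟨1 - 1 / (2 * √N), by linarith, by linarith, ?_⟩
  rw [sub_sub_cancel, div_pow, mul_pow, Real.sq_sqrt hN0.le]
  field_simp
  norm_num

/-- Lower bound without covariates: for every non-anticipating allocation
mechanism `a` and every measurable estimator `T` of the collected data, there exists a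
Gaussian two-arm instance `(μ1, μ0, σ1, σ0)` with `σ1, σ0 > 0` on which
`E[(τ̂ − τ)²] ≥ (σ⁽¹⁾+σ⁽⁰⁾)²/n + (σ⁽¹⁾+σ⁽⁰⁾)²/(1000 n²)`. -/
theorem statement_6 (n : ℕ) (hn : 1 ≤ n)
    (a : (i : ℕ) → (Fin i → Bool × ℝ) → ℝ → Bool)
    (ha : ∀ i, Measurable fun p : (Fin i → Bool × ℝ) × ℝ => a i p.1 p.2)
    (T : (Fin n → Bool × ℝ) → ℝ) (hT : Measurable T) :
    ∃ μ1 μ0 σ1 σ0 : ℝ, 0 < σ1 ∧ 0 < σ0 ∧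
      ENNReal.ofReal ((σ1 + σ0) ^ 2 / n + (σ1 + σ0) ^ 2 / (1000 * (n : ℝ) ^ 2)) ≤
        ∫⁻ ω, ENNReal.ofReal
          ((T (data n a μ1 μ0 σ1 σ0 ω) - (μ1 - μ0)) ^ 2) ∂(Pbase n) := by
  have hn1 : (1 : ℝ) ≤ n := by exact_mod_cast hn
  obtain ⟨r, hr0, hr1, hr⟩ := exists_near_one_sd hn1
  have hq := three_quarters_le_affinity_pow hr0 hr (by nlinarith)
  obtain ⟨V, hV, hV'⟩ : ∃ V : NNReal, V ≠ 0 ∧ (V : ℝ)⁻¹ = 1 / 100 :=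
    ⟨100, by norm_num, by norm_num⟩
  have hlt := two_mul_risk_bound_lt hn1 hr0 hr1 hr hq
  have hle := le_bayes_risk_add_bayes_risk n a ha hT hV hr0 hr1
  rw [hV'] at hle
  by_contra! hcon
  obtain ⟨b, hb⟩ : ∃ b, b = (1 + r) ^ 2 / (n : ℝ) + (1 + r) ^ 2 / (1000 * (n : ℝ) ^ 2) := ⟨_, rfl⟩
  have hb0 : 0 ≤ b := by rw [hb]; positivity
  rw [← hb] at hlt
  have hbound : ∀ σ1 σ0 : ℝ, 0 < σ1 → 0 < σ0 → σ1 + σ0 = 1 + r →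
      ∫⁻ p, ∫⁻ ω, ENNReal.ofReal ((T (data n a p.1 p.2 σ1 σ0 ω) - (p.1 - p.2)) ^ 2) ∂(Pbase n)
        ∂((gaussianReal 0 V).prod (gaussianReal 0 V)) ≤ ENNReal.ofReal b := by
    intro σ1 σ0 h1 h0 hs
    have hc : ∀ p : ℝ × ℝ,
        ∫⁻ ω, ENNReal.ofReal ((T (data n a p.1 p.2 σ1 σ0 ω) - (p.1 - p.2)) ^ 2) ∂(Pbase n) ≤
          ENNReal.ofReal b := by
      intro p
      have h := (hcon p.1 p.2 σ1 σ0 h1 h0).le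
      rwa [hs, ← hb] at h
    refine (lintegral_mono hc).trans ?_
    rw [lintegral_const, measure_univ, mul_one]
  have h := hle.trans
    (add_le_add (hbound 1 r one_pos hr0 rfl) (hbound r 1 hr0 one_pos (add_comm r 1)))
  rw [← ENNReal.ofReal_add hb0 hb0, ENNReal.ofReal_le_ofReal_iff (by positivity)] at h
  linarith

end LowerBound
end

section
/- Under the sequential experiment with covariates, E[(τ̂₂ˣ − τ)²] − E[(τ̂*ˣ − τ)²] = (1/n²) · E[ Σ_{i=1}^n (σ⁽¹⁾(X_i))²/e_i(X_i) + Σ_{i=1}^n (σ⁽⁰⁾(X_i))²/(1 − e_i(X_i)) − n·( (σ⁽¹⁾(X_i))²/e*(X_i) + (σ⁽⁰⁾(X_i))²/(1 − e*(X_i)) ) ], where e*(x) = σ⁽¹⁾(x)/(σ⁽¹⁾(x) + σ⁽⁰⁾(x)). -/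
open MeasureTheory ProbabilityTheory

namespace CovariateExperiment

/-- The intermediary AIPW estimator `τ̂₂ˣ` using the true mean functions. -/
noncomputable def tauHat2X {Ω 𝒳 : Type*} (n : ℕ) (μ1 μ0 : 𝒳 → ℝ)
    (X : Fin n → Ω → 𝒳) (W Y : Fin n → Ω → ℝ) (e : Fin n → Ω → 𝒳 → ℝ) (ω : Ω) : ℝ :=
  (1 / (n : ℝ)) * ∑ i : Fin n, (μ1 (X i ω) - μ0 (X i ω)
    + (Y i ω - μ1 (X i ω)) * W i ω / e i ω (X i ω)
    - (Y i ω - μ0 (X i ω)) * (1 - W i ω) / (1 - e i ω (X i ω)))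

/-- A sequential (possibly adaptive) experiment with covariates: i.i.d. covariates with
law `PX`, mean functions `μ1, μ0`, standard-deviation functions `σ1, σ0 > 0`,
filtration `F`, covariates `X`, treatments `W`, outcomes `Y` and (random,
`𝓕_{i−1}`-measurable) propensity functions `e i : Ω → 𝒳 → (0,1)`. -/
structure IsSeqExpX {Ω 𝒳 : Type*} [m0 : MeasurableSpace Ω] [m𝒳 : MeasurableSpace 𝒳]
    (P : Measure Ω) (PX : Measure 𝒳) (n : ℕ)
    (μ1 μ0 σ1 σ0 : 𝒳 → ℝ) (F : ℕ → MeasurableSpace Ω)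
    (X : Fin n → Ω → 𝒳) (W Y : Fin n → Ω → ℝ)
    (e : Fin n → Ω → 𝒳 → ℝ) : Prop where
  isProb : IsProbabilityMeasure P
  isProbX : IsProbabilityMeasure PX
  mu1_meas : Measurable μ1
  mu0_meas : Measurable μ0
  sigma1_meas : Measurable σ1
  sigma0_meas : Measurable σ0
  /-- the mean functions are bounded -/
  mu_bdd : ∃ M : ℝ, ∀ x, |μ1 x| ≤ M ∧ |μ0 x| ≤ M
  /-- the standard-deviation functions are positive -/
  sigma_pos : ∀ x, 0 < σ1 x ∧ 0 < σ0 x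
  F_mono : Monotone F
  F_le : ∀ k, F k ≤ m0
  /-- the data of unit `i` is `𝓕ᵢ`-measurable -/
  X_meas : ∀ i : Fin n, Measurable[F (i.val + 1)] (X i)
  W_meas : ∀ i : Fin n, Measurable[F (i.val + 1)] (W i)
  Y_meas : ∀ i : Fin n, Measurable[F (i.val + 1)] (Y i)
  /-- the covariates are i.i.d. with law `PX`: each `Xᵢ` has law `PX` and is
  independent of the past -/
  X_law : ∀ i : Fin n, Measure.map (X i) P = PX
  X_indep : ∀ i : Fin n, Indep (MeasurableSpace.comap (X i) m𝒳) (F i.val) P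
  /-- the propensity function of round `i` is `𝓕_{i−1}`-measurable -/
  e_meas : ∀ i : Fin n,
    Measurable[(F i.val).prod m𝒳] (fun p : Ω × 𝒳 => e i p.1 p.2)
  e_mem : ∀ i ω x, e i ω x ∈ Set.Ioo (0 : ℝ) 1
  W_bool : ∀ i ω, W i ω = 0 ∨ W i ω = 1
  /-- `P(Wᵢ = 1 | 𝓕_{i−1}, Xᵢ) = eᵢ(Xᵢ)` -/
  W_condexp : ∀ i : Fin n,
    P[W i|F i.val ⊔ MeasurableSpace.comap (X i) m𝒳] =ᵐ[P]
      fun ω => e i ω (X i ω)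
  /-- conditionally on `𝓕_{i−1}, Xᵢ, Wᵢ`, the outcome has mean `μ^{(Wᵢ)}(Xᵢ)` -/
  Y_mean : ∀ i : Fin n,
    P[Y i|F i.val ⊔ MeasurableSpace.comap (X i) m𝒳 ⊔
        MeasurableSpace.comap (W i) (inferInstance : MeasurableSpace ℝ)] =ᵐ[P]
      fun ω => μ1 (X i ω) * W i ω + μ0 (X i ω) * (1 - W i ω)
  /-- conditionally on `𝓕_{i−1}, Xᵢ, Wᵢ`, the outcome has variance `(σ^{(Wᵢ)}(Xᵢ))²` -/
  Y_var : ∀ i : Fin n,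
    P[(fun ω => (Y i ω - (μ1 (X i ω) * W i ω + μ0 (X i ω) * (1 - W i ω))) ^ 2)|
        F i.val ⊔ MeasurableSpace.comap (X i) m𝒳 ⊔
          MeasurableSpace.comap (W i) (inferInstance : MeasurableSpace ℝ)] =ᵐ[P]
      fun ω => (σ1 (X i ω)) ^ 2 * W i ω + (σ0 (X i ω)) ^ 2 * (1 - W i ω)
  /-- integrability of all the squares appearing in the analysis -/
  int_Y_sq : ∀ i : Fin n, Integrable (fun ω => (Y i ω) ^ 2) P
  int_term_sq : ∀ i : Fin n, Integrable
    (fun ω => ((Y i ω - μ1 (X i ω)) * W i ω / e i ω (X i ω)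
      - (Y i ω - μ0 (X i ω)) * (1 - W i ω) / (1 - e i ω (X i ω))) ^ 2) P
  int_var_e : ∀ i : Fin n, Integrable
    (fun ω => (σ1 (X i ω)) ^ 2 / e i ω (X i ω)
      + (σ0 (X i ω)) ^ 2 / (1 - e i ω (X i ω))) P
  int_sigma_sq : Integrable (fun x => (σ1 x + σ0 x) ^ 2) PX

/-- A factor measurable with respect to the conditioning σ-algebra can be
pulled out of a conditional expectation inside an integral. -/
theorem integral_mul_eq_of_condExp_ae_eq {Ω : Type*} {m m0 : MeasurableSpace Ω} {P : Measure Ω}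
    [IsFiniteMeasure P] (hm : m ≤ m0) {c U V : Ω → ℝ} (hc : Measurable[m] c)
    (hU : Integrable U P) (hcU : Integrable (fun ω => c ω * U ω) P) (hV : P[U|m] =ᵐ[P] V) :
    Integrable (fun ω => c ω * V ω) P ∧ ∫ ω, c ω * U ω ∂P = ∫ ω, c ω * V ω ∂P := by
  have hpull : P[c * U|m] =ᵐ[P] fun ω => c ω * V ω := by
    filter_upwards [condExp_mul_of_stronglyMeasurable_left hc.stronglyMeasurable hcU hU, hV]
      with ω h1 h2
    rw [h1, Pi.mul_apply, h2]
  exact ⟨integrable_condExp.congr hpull,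
    (integral_condExp hm (f := c * U)).symm.trans (integral_congr_ae hpull)⟩

/-- The second moment of a sum of pairwise orthogonal square-integrable variables is the sum of
the second moments. -/
theorem integral_sq_sum_of_orthogonal {Ω ι : Type*} [MeasurableSpace Ω] [Fintype ι]
    {P : Measure Ω} {S : ι → Ω → ℝ} (hS : ∀ i, MemLp (S i) 2 P)
    (horth : ∀ i j, i ≠ j → ∫ ω, S i ω * S j ω ∂P = 0) :
    ∫ ω, (∑ i, S i ω) ^ 2 ∂P = ∑ i, ∫ ω, S i ω ^ 2 ∂P := by
  have hint : ∀ i j, Integrable (fun ω => S i ω * S j ω) P := fun i j =>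
    (hS i).integrable_mul (hS j)
  simp_rw [sq, Finset.sum_mul_sum]
  rw [integral_finsetSum _ fun i _ => integrable_finsetSum _ fun j _ => hint i j]
  refine Finset.sum_congr rfl fun i _ => ?_
  rw [integral_finsetSum _ fun j _ => hint i j,
    Finset.sum_eq_single i (fun j _ hj => horth i j hj.symm) (by simp)]

namespace IsSeqExpX

variable {Ω 𝒳 : Type*} [m𝒳 : MeasurableSpace 𝒳] {n : ℕ} {F : ℕ → MeasurableSpace Ω}
  {X : Fin n → Ω → 𝒳} {W : Fin n → Ω → ℝ}

/-- The past together with the current covariate. -/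
abbrev preTreatment (F : ℕ → MeasurableSpace Ω) (X : Fin n → Ω → 𝒳) (i : Fin n) :
    MeasurableSpace Ω :=
  F i.val ⊔ MeasurableSpace.comap (X i) m𝒳

/-- The past together with the current covariate and treatment. -/
abbrev preOutcome (F : ℕ → MeasurableSpace Ω) (X : Fin n → Ω → 𝒳) (W : Fin n → Ω → ℝ)
    (i : Fin n) : MeasurableSpace Ω :=
  F i.val ⊔ MeasurableSpace.comap (X i) m𝒳 ⊔
    MeasurableSpace.comap (W i) (inferInstance : MeasurableSpace ℝ)

theorem measurable_X_preTreatment (i : Fin n) : Measurable[preTreatment F X i] (X i) :=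
  (comap_measurable (X i)).mono le_sup_right le_rfl

theorem measurable_W_preOutcome (i : Fin n) : Measurable[preOutcome F X W i] (W i) :=
  (comap_measurable (W i)).mono le_sup_right le_rfl

/-- The conditional mean of the outcome given the past, the covariate and the treatment. -/
def outcomeMean (μ1 μ0 : 𝒳 → ℝ) (X : Fin n → Ω → 𝒳) (W : Fin n → Ω → ℝ) (i : Fin n) (ω : Ω) : ℝ :=
  μ1 (X i ω) * W i ω + μ0 (X i ω) * (1 - W i ω)

/-- The inverse-propensity-weighted residual of round `i`. -/
noncomputable def ipwResidual (μ1 μ0 : 𝒳 → ℝ) (X : Fin n → Ω → 𝒳) (W Y : Fin n → Ω → ℝ)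
    (e : Fin n → Ω → 𝒳 → ℝ) (i : Fin n) (ω : Ω) : ℝ :=
  (Y i ω - μ1 (X i ω)) * W i ω / e i ω (X i ω)
    - (Y i ω - μ0 (X i ω)) * (1 - W i ω) / (1 - e i ω (X i ω))

variable [m0 : MeasurableSpace Ω] {P : Measure Ω} {PX : Measure 𝒳} {μ1 μ0 σ1 σ0 : 𝒳 → ℝ}
  {Y : Fin n → Ω → ℝ} {e : Fin n → Ω → 𝒳 → ℝ}

theorem preTreatment_le (h : IsSeqExpX P PX n μ1 μ0 σ1 σ0 F X W Y e) (i : Fin n) :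
    preTreatment F X i ≤ F (i.val + 1) :=
  sup_le (h.F_mono (Nat.le_succ _)) (h.X_meas i).comap_le

theorem preOutcome_le (h : IsSeqExpX P PX n μ1 μ0 σ1 σ0 F X W Y e) (i : Fin n) :
    preOutcome F X W i ≤ F (i.val + 1) :=
  sup_le (h.preTreatment_le i) (h.W_meas i).comap_le

theorem measurable_propensity (h : IsSeqExpX P PX n μ1 μ0 σ1 σ0 F X W Y e) (i : Fin n) :
    Measurable[preTreatment F X i] fun ω => e i ω (X i ω) := by
  have hpair : @Measurable _ _ (preTreatment F X i) ((F i.val).prod m𝒳) fun ω => (ω, X i ω) :=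
    @Measurable.prodMk _ (preTreatment F X i) _ _ (F i.val) m𝒳 _ _
      (measurable_id.mono le_sup_left le_rfl) (measurable_X_preTreatment i)
  exact (h.e_meas i).comp hpair

theorem measurable_ipwResidual (h : IsSeqExpX P PX n μ1 μ0 σ1 σ0 F X W Y e) (i : Fin n) :
    Measurable[F (i.val + 1)] (ipwResidual μ1 μ0 X W Y e i) := by
  have he := (h.measurable_propensity i).mono (h.preTreatment_le i) le_rfl
  have h1 := h.mu1_meas.comp (h.X_meas i)
  have h0 := h.mu0_meas.comp (h.X_meas i)
  have hW := h.W_meas i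
  have hY := h.Y_meas i
  exact (((hY.sub h1).mul hW).div he).sub
    (((hY.sub h0).mul (measurable_const.sub hW)).div (measurable_const.sub he))

theorem memLp_ipwResidual (h : IsSeqExpX P PX n μ1 μ0 σ1 σ0 F X W Y e) (i : Fin n) :
    MemLp (ipwResidual μ1 μ0 X W Y e i) 2 P :=
  (memLp_two_iff_integrable_sq
    ((h.measurable_ipwResidual i).mono (h.F_le _) le_rfl).aestronglyMeasurable).2
    (h.int_term_sq i)

theorem memLp_outcome_sub_mean (h : IsSeqExpX P PX n μ1 μ0 σ1 σ0 F X W Y e) (i : Fin n) :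
    MemLp (fun ω => Y i ω - outcomeMean μ1 μ0 X W i ω) 2 P := by
  have := h.isProb
  obtain ⟨M, hM⟩ := h.mu_bdd
  have hX := (h.X_meas i).mono (h.F_le _) le_rfl
  have hW := (h.W_meas i).mono (h.F_le _) le_rfl
  have hY := (h.Y_meas i).mono (h.F_le _) le_rfl
  refine MemLp.sub ((memLp_two_iff_integrable_sq hY.aestronglyMeasurable).2 (h.int_Y_sq i)) ?_
  refine MemLp.of_bound (C := M) ?_ (ae_of_all _ fun ω => ?_)
  · exact (((h.mu1_meas.comp hX).mul hW).add
      ((h.mu0_meas.comp hX).mul (measurable_const.sub hW))).aestronglyMeasurable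
  · rcases h.W_bool i ω with hw | hw
    · simpa [outcomeMean, hw] using (hM (X i ω)).2
    · simpa [outcomeMean, hw] using (hM (X i ω)).1

theorem condExp_outcome_sub_mean (h : IsSeqExpX P PX n μ1 μ0 σ1 σ0 F X W Y e) (i : Fin n) :
    P[fun ω => Y i ω - outcomeMean μ1 μ0 X W i ω|preOutcome F X W i] =ᵐ[P] fun _ => 0 := by
  have := h.isProb
  have hle := (h.preOutcome_le i).trans (h.F_le _)
  have hY := (h.Y_meas i).mono (h.F_le _) le_rfl
  have hYint : Integrable (Y i) P :=
    ((memLp_two_iff_integrable_sq hY.aestronglyMeasurable).2 (h.int_Y_sq i)).integrable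
      (by norm_num)
  have hm : Integrable (outcomeMean μ1 μ0 X W i) P := by
    refine (hYint.sub ((h.memLp_outcome_sub_mean i).integrable (by norm_num))).congr
      (ae_of_all _ fun ω => ?_)
    simp
  have hX : Measurable[preOutcome F X W i] (X i) :=
    (measurable_X_preTreatment i).mono le_sup_left le_rfl
  have hW : Measurable[preOutcome F X W i] (W i) := measurable_W_preOutcome i
  have hmeas : Measurable[preOutcome F X W i] (outcomeMean μ1 μ0 X W i) :=
    ((h.mu1_meas.comp hX).mul hW).add ((h.mu0_meas.comp hX).mul (measurable_const.sub hW))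
  have hsub := condExp_sub hYint hm (preOutcome F X W i)
  rw [condExp_of_stronglyMeasurable hle hmeas.stronglyMeasurable hm] at hsub
  filter_upwards [hsub, h.Y_mean i] with ω h1 h2
  refine h1.trans ?_
  rw [Pi.sub_apply, h2]
  exact sub_self _

theorem ipwResidual_eq (h : IsSeqExpX P PX n μ1 μ0 σ1 σ0 F X W Y e) (i : Fin n) (ω : Ω) :
    ipwResidual μ1 μ0 X W Y e i ω =
      (W i ω / e i ω (X i ω) - (1 - W i ω) / (1 - e i ω (X i ω))) *
        (Y i ω - outcomeMean μ1 μ0 X W i ω) := by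
  rcases h.W_bool i ω with hw | hw <;> simp [ipwResidual, outcomeMean, hw] <;> ring

theorem integral_mul_ipwResidual_eq_zero (h : IsSeqExpX P PX n μ1 μ0 σ1 σ0 F X W Y e)
    (i : Fin n) {g : Ω → ℝ} (hg : Measurable[preOutcome F X W i] g) (hgL : MemLp g 2 P) :
    ∫ ω, g ω * ipwResidual μ1 μ0 X W Y e i ω ∂P = 0 := by
  have := h.isProb
  have he : Measurable[preOutcome F X W i] fun ω => e i ω (X i ω) :=
    (h.measurable_propensity i).mono le_sup_left le_rfl
  have hW : Measurable[preOutcome F X W i] (W i) := measurable_W_preOutcome i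
  have hint : Integrable (fun ω => g ω * ipwResidual μ1 μ0 X W Y e i ω) P :=
    hgL.integrable_mul (h.memLp_ipwResidual i)
  simp_rw [h.ipwResidual_eq i, ← mul_assoc] at hint ⊢
  refine (integral_mul_eq_of_condExp_ae_eq ((h.preOutcome_le i).trans (h.F_le _))
    (hg.mul ((hW.div he).sub ((measurable_const.sub hW).div (measurable_const.sub he))))
    ((h.memLp_outcome_sub_mean i).integrable (by norm_num)) hint
    (h.condExp_outcome_sub_mean i)).2.trans ?_
  simp

theorem integral_ipwResidual_sq (h : IsSeqExpX P PX n μ1 μ0 σ1 σ0 F X W Y e) (i : Fin n) :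
    ∫ ω, ipwResidual μ1 μ0 X W Y e i ω ^ 2 ∂P =
      ∫ ω, (σ1 (X i ω) ^ 2 / e i ω (X i ω) + σ0 (X i ω) ^ 2 / (1 - e i ω (X i ω))) ∂P := by
  have := h.isProb
  have heG := h.measurable_propensity i
  have he : Measurable[preOutcome F X W i] fun ω => e i ω (X i ω) := heG.mono le_sup_left le_rfl
  have hW : Measurable[preOutcome F X W i] (W i) := measurable_W_preOutcome i
  have hX : Measurable[preTreatment F X i] (X i) := measurable_X_preTreatment i
  have hleG := (h.preTreatment_le i).trans (h.F_le _)
  have hle := (h.preOutcome_le i).trans (h.F_le _)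
  have hWint : Integrable (W i) P := by
    refine Integrable.of_bound (hW.mono hle le_rfl).aestronglyMeasurable 1 (ae_of_all _ fun ω => ?_)
    rcases h.W_bool i ω with hw | hw <;> simp [hw]
  have hW' : P[fun ω => 1 - W i ω|preTreatment F X i] =ᵐ[P] fun ω => 1 - e i ω (X i ω) := by
    have hsub := condExp_sub (integrable_const (1 : ℝ)) hWint (preTreatment F X i)
    rw [condExp_const hleG] at hsub
    filter_upwards [hsub, h.W_condexp i] with ω h1 h2
    refine h1.trans ?_
    rw [Pi.sub_apply, h2]
  have hsq : ∀ ω, ipwResidual μ1 μ0 X W Y e i ω ^ 2 =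
      (W i ω / e i ω (X i ω) - (1 - W i ω) / (1 - e i ω (X i ω))) ^ 2 *
        (Y i ω - outcomeMean μ1 μ0 X W i ω) ^ 2 := fun ω => by
    rw [h.ipwResidual_eq, mul_pow]
  have hint : Integrable (fun ω => ipwResidual μ1 μ0 X W Y e i ω ^ 2) P := h.int_term_sq i
  simp_rw [hsq] at hint ⊢
  obtain ⟨hI, hE⟩ := integral_mul_eq_of_condExp_ae_eq hle
    (((hW.div he).sub ((measurable_const.sub hW).div (measurable_const.sub he))).pow_const 2)
    (h.memLp_outcome_sub_mean i).integrable_sq hint (h.Y_var i)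
  have hsplit : ∀ ω, (W i ω / e i ω (X i ω) - (1 - W i ω) / (1 - e i ω (X i ω))) ^ 2 *
      (σ1 (X i ω) ^ 2 * W i ω + σ0 (X i ω) ^ 2 * (1 - W i ω)) =
      σ1 (X i ω) ^ 2 / e i ω (X i ω) ^ 2 * W i ω +
        σ0 (X i ω) ^ 2 / (1 - e i ω (X i ω)) ^ 2 * (1 - W i ω) := fun ω => by
    rcases h.W_bool i ω with hw | hw <;> simp [hw] <;> ring
  have hW01 : ∀ ω, 0 ≤ W i ω ∧ 0 ≤ 1 - W i ω := fun ω => by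
    rcases h.W_bool i ω with hw | hw <;> simp [hw]
  have hc1 : Measurable[preTreatment F X i]
      fun ω => σ1 (X i ω) ^ 2 / e i ω (X i ω) ^ 2 :=
    ((h.sigma1_meas.comp hX).pow_const 2).div (heG.pow_const 2)
  have hc0 : Measurable[preTreatment F X i]
      fun ω => σ0 (X i ω) ^ 2 / (1 - e i ω (X i ω)) ^ 2 :=
    ((h.sigma0_meas.comp hX).pow_const 2).div ((measurable_const.sub heG).pow_const 2)
  have hWm := hW.mono hle le_rfl
  replace hI : Integrable _ P := hI.congr (ae_of_all _ hsplit)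
  replace hE := hE.trans (integral_congr_ae (ae_of_all _ hsplit))
  have hI1 : Integrable (fun ω => σ1 (X i ω) ^ 2 / e i ω (X i ω) ^ 2 * W i ω) P := by
    refine hI.mono' ((hc1.mono hleG le_rfl).mul hWm).aestronglyMeasurable
      (ae_of_all _ fun ω => ?_)
    have := hW01 ω
    rw [Real.norm_of_nonneg (mul_nonneg (by positivity) this.1)]
    exact le_add_of_nonneg_right (mul_nonneg (by positivity) this.2)
  have hI0 : Integrable
      (fun ω => σ0 (X i ω) ^ 2 / (1 - e i ω (X i ω)) ^ 2 * (1 - W i ω)) P := by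
    refine hI.mono' ((hc0.mono hleG le_rfl).mul (measurable_const.sub hWm)).aestronglyMeasurable
      (ae_of_all _ fun ω => ?_)
    have := hW01 ω
    rw [Real.norm_of_nonneg (mul_nonneg (by positivity) this.2)]
    exact le_add_of_nonneg_left (mul_nonneg (by positivity) this.1)
  obtain ⟨hJ1, hE1⟩ := integral_mul_eq_of_condExp_ae_eq hleG hc1 hWint hI1 (h.W_condexp i)
  obtain ⟨hJ0, hE0⟩ := integral_mul_eq_of_condExp_ae_eq hleG hc0
    ((integrable_const (1 : ℝ)).sub hWint) hI0 hW'
  refine hE.trans ?_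
  rw [integral_add hI1 hI0, hE1]
  refine (congrArg _ hE0).trans ?_
  rw [← integral_add hJ1 hJ0]
  refine integral_congr_ae (ae_of_all _ fun ω => ?_)
  have hmem := h.e_mem i ω (X i ω)
  have h1 : e i ω (X i ω) ≠ 0 := hmem.1.ne'
  have h0 : 1 - e i ω (X i ω) ≠ 0 := (sub_pos.2 hmem.2).ne'
  dsimp only
  field_simp

/-- The centred summand of the estimator error in round `i`. -/
noncomputable def centredSummand (PX : Measure 𝒳) (μ1 μ0 : 𝒳 → ℝ) (X : Fin n → Ω → 𝒳)
    (W Y : Fin n → Ω → ℝ) (e : Fin n → Ω → 𝒳 → ℝ) (i : Fin n) (ω : Ω) : ℝ :=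
  (μ1 (X i ω) - μ0 (X i ω) - ∫ x, (μ1 x - μ0 x) ∂PX) + ipwResidual μ1 μ0 X W Y e i ω

theorem memLp_centred_effect (h : IsSeqExpX P PX n μ1 μ0 σ1 σ0 F X W Y e) (i : Fin n) :
    MemLp (fun ω => μ1 (X i ω) - μ0 (X i ω) - ∫ x, (μ1 x - μ0 x) ∂PX) 2 P := by
  have := h.isProb
  obtain ⟨M, hM⟩ := h.mu_bdd
  have hX := (h.X_meas i).mono (h.F_le _) le_rfl
  refine MemLp.sub (MemLp.sub ?_ ?_) (memLp_const _)
  · exact MemLp.of_bound (h.mu1_meas.comp hX).aestronglyMeasurable M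
      (ae_of_all _ fun ω => (hM (X i ω)).1)
  · exact MemLp.of_bound (h.mu0_meas.comp hX).aestronglyMeasurable M
      (ae_of_all _ fun ω => (hM (X i ω)).2)

theorem integral_comp_X (h : IsSeqExpX P PX n μ1 μ0 σ1 σ0 F X W Y e) (i : Fin n) {f : 𝒳 → ℝ}
    (hf : Measurable f) : ∫ ω, f (X i ω) ∂P = ∫ x, f x ∂PX := by
  rw [← h.X_law i, integral_map ((h.X_meas i).mono (h.F_le _) le_rfl).aemeasurable
    hf.aestronglyMeasurable]

theorem integral_centred_effect (h : IsSeqExpX P PX n μ1 μ0 σ1 σ0 F X W Y e) (i : Fin n) :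
    ∫ ω, (μ1 (X i ω) - μ0 (X i ω) - ∫ x, (μ1 x - μ0 x) ∂PX) ∂P = 0 := by
  have := h.isProb
  have hint : Integrable (fun ω => μ1 (X i ω) - μ0 (X i ω)) P := by
    refine (((h.memLp_centred_effect i).integrable (by norm_num)).add
      (integrable_const (∫ x, (μ1 x - μ0 x) ∂PX))).congr (ae_of_all _ fun ω => ?_)
    simp
  rw [integral_sub hint (integrable_const _),
    h.integral_comp_X i (f := fun x => μ1 x - μ0 x) (h.mu1_meas.sub h.mu0_meas)]
  simp

theorem memLp_centredSummand (h : IsSeqExpX P PX n μ1 μ0 σ1 σ0 F X W Y e) (i : Fin n) :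
    MemLp (centredSummand PX μ1 μ0 X W Y e i) 2 P :=
  (h.memLp_centred_effect i).add (h.memLp_ipwResidual i)

theorem measurable_centredSummand (h : IsSeqExpX P PX n μ1 μ0 σ1 σ0 F X W Y e) (i : Fin n) :
    Measurable[F (i.val + 1)] (centredSummand PX μ1 μ0 X W Y e i) :=
  (((h.mu1_meas.comp (h.X_meas i)).sub (h.mu0_meas.comp (h.X_meas i))).sub
    measurable_const).add (h.measurable_ipwResidual i)

theorem integral_centredSummand_mul_of_lt (h : IsSeqExpX P PX n μ1 μ0 σ1 σ0 F X W Y e)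
    {j i : Fin n} (hji : j < i) :
    ∫ ω, centredSummand PX μ1 μ0 X W Y e j ω * centredSummand PX μ1 μ0 X W Y e i ω ∂P = 0 := by
  have := h.isProb
  have hSj : Measurable[F i.val] (centredSummand PX μ1 μ0 X W Y e j) :=
    (h.measurable_centredSummand j).mono (h.F_mono hji) le_rfl
  have hLj := h.memLp_centredSummand j
  have hT := h.memLp_centred_effect i
  have hindep : IndepFun (centredSummand PX μ1 μ0 X W Y e j)
      (fun ω => μ1 (X i ω) - μ0 (X i ω) - ∫ x, (μ1 x - μ0 x) ∂PX) P := by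
    rw [IndepFun_iff_Indep]
    refine indep_of_indep_of_le_left (indep_of_indep_of_le_right (h.X_indep i).symm ?_)
      hSj.comap_le
    exact Measurable.comap_le (((h.mu1_meas.comp (comap_measurable (X i))).sub
      (h.mu0_meas.comp (comap_measurable (X i)))).sub measurable_const)
  have h1 : ∫ ω, centredSummand PX μ1 μ0 X W Y e j ω *
      (μ1 (X i ω) - μ0 (X i ω) - ∫ x, (μ1 x - μ0 x) ∂PX) ∂P = 0 := by
    rw [hindep.integral_fun_mul_eq_mul_integral hLj.aestronglyMeasurable hT.aestronglyMeasurable,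
      h.integral_centred_effect i, mul_zero]
  have h2 := h.integral_mul_ipwResidual_eq_zero i
    (hSj.mono (le_sup_left.trans le_sup_left) le_rfl) hLj
  have hadd := integral_add (hLj.integrable_mul hT) (hLj.integrable_mul (h.memLp_ipwResidual i))
  simp only [Pi.mul_apply, h1, h2, add_zero, ← mul_add] at hadd
  exact hadd

theorem integral_centredSummand_sq (h : IsSeqExpX P PX n μ1 μ0 σ1 σ0 F X W Y e) (i : Fin n) :
    ∫ ω, centredSummand PX μ1 μ0 X W Y e i ω ^ 2 ∂P =
      ∫ x, (μ1 x - μ0 x - ∫ y, (μ1 y - μ0 y) ∂PX) ^ 2 ∂PX +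
        ∫ ω, (σ1 (X i ω) ^ 2 / e i ω (X i ω) + σ0 (X i ω) ^ 2 / (1 - e i ω (X i ω))) ∂P := by
  have hT := h.memLp_centred_effect i
  have hD := h.memLp_ipwResidual i
  have hX : Measurable[preOutcome F X W i] (X i) :=
    (measurable_X_preTreatment i).mono le_sup_left le_rfl
  have hcross := h.integral_mul_ipwResidual_eq_zero i
    (((h.mu1_meas.comp hX).sub (h.mu0_meas.comp hX)).sub measurable_const) hT
  have hcrossInt := (hT.integrable_mul hD).const_mul 2
  rw [← h.integral_ipwResidual_sq i, ← h.integral_comp_X i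
    (f := fun x => (μ1 x - μ0 x - ∫ y, (μ1 y - μ0 y) ∂PX) ^ 2)
    (((h.mu1_meas.sub h.mu0_meas).sub measurable_const).pow_const 2)]
  have hadd := integral_add (hT.integrable_sq.add hcrossInt) hD.integrable_sq
  rw [integral_add' hT.integrable_sq hcrossInt, integral_const_mul] at hadd
  refine (integral_congr_ae (ae_of_all _ fun ω => ?_)).trans
    (hadd.trans (congrArg (· + _) ?_))
  · simp only [centredSummand, Pi.add_apply, Pi.mul_apply]
    ring
  · refine (congrArg (fun t => _ + 2 * t) hcross).trans ?_
    simp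

/-- The mean squared error of the intermediary estimator. -/
theorem integral_sq_error (h : IsSeqExpX P PX n μ1 μ0 σ1 σ0 F X W Y e) (hn : 1 ≤ n) :
    ∫ ω, (tauHat2X n μ1 μ0 X W Y e ω - ∫ x, (μ1 x - μ0 x) ∂PX) ^ 2 ∂P =
      1 / (n : ℝ) ^ 2 * (n * ∫ x, (μ1 x - μ0 x - ∫ y, (μ1 y - μ0 y) ∂PX) ^ 2 ∂PX +
        ∑ i, ∫ ω, (σ1 (X i ω) ^ 2 / e i ω (X i ω) + σ0 (X i ω) ^ 2 / (1 - e i ω (X i ω))) ∂P) := by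
  have hn0 : (n : ℝ) ≠ 0 := by positivity
  have herr : ∀ ω, (tauHat2X n μ1 μ0 X W Y e ω - ∫ x, (μ1 x - μ0 x) ∂PX) ^ 2 =
      1 / (n : ℝ) ^ 2 * (∑ i, centredSummand PX μ1 μ0 X W Y e i ω) ^ 2 := fun ω => by
    have hsum : ∑ i, centredSummand PX μ1 μ0 X W Y e i ω =
        n * (tauHat2X n μ1 μ0 X W Y e ω - ∫ x, (μ1 x - μ0 x) ∂PX) := by
      rw [tauHat2X, mul_sub, ← mul_assoc, mul_one_div_cancel hn0, one_mul]
      have hconst : (n : ℝ) * ∫ x, (μ1 x - μ0 x) ∂PX =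
          ∑ _i : Fin n, ∫ x, (μ1 x - μ0 x) ∂PX := by simp
      rw [hconst, ← Finset.sum_sub_distrib]
      refine Finset.sum_congr rfl fun i _ => ?_
      simp only [centredSummand, ipwResidual]
      ring
    rw [hsum]
    field_simp
  simp_rw [herr]
  rw [integral_const_mul, integral_sq_sum_of_orthogonal h.memLp_centredSummand]
  · simp_rw [h.integral_centredSummand_sq, Finset.sum_add_distrib]
    simp
  · intro i j hij
    rcases lt_or_gt_of_ne hij with hlt | hlt
    · exact h.integral_centredSummand_mul_of_lt hlt
    · simp_rw [mul_comm (centredSummand PX μ1 μ0 X W Y e i _)]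
      exact h.integral_centredSummand_mul_of_lt hlt

end IsSeqExpX

/-- Comparing the intermediary estimator `τ̂₂ˣ` of an arbitrary
(non-anticipating) sequential experiment with covariates to the idealized optimal
estimator `τ̂*ˣ` (the same estimator computed from data collected under the generalized
Neyman allocation `e*(x) = σ⁽¹⁾(x)/(σ⁽¹⁾(x)+σ⁽⁰⁾(x))`):
`E[(τ̂₂ˣ − τ)²] − E[(τ̂*ˣ − τ)²]
  = (1/n²)·E[ Σᵢ (σ⁽¹⁾(Xᵢ))²/eᵢ(Xᵢ) + Σᵢ (σ⁽⁰⁾(Xᵢ))²/(1 − eᵢ(Xᵢ))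
      − n((σ⁽¹⁾(Xᵢ))²/e*(Xᵢ) + (σ⁽⁰⁾(Xᵢ))²/(1 − e*(Xᵢ))) ]`. -/
theorem statement_9 {Ω Ω' 𝒳 : Type*} [MeasurableSpace Ω] [MeasurableSpace Ω']
    [MeasurableSpace 𝒳] (P : Measure Ω) (P' : Measure Ω') (PX : Measure 𝒳)
    (n : ℕ) (hn : 1 ≤ n) (μ1 μ0 σ1 σ0 : 𝒳 → ℝ)
    (F : ℕ → MeasurableSpace Ω) (X : Fin n → Ω → 𝒳) (W Y : Fin n → Ω → ℝ)
    (e : Fin n → Ω → 𝒳 → ℝ)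
    (F' : ℕ → MeasurableSpace Ω') (X' : Fin n → Ω' → 𝒳) (W' Y' : Fin n → Ω' → ℝ)
    (e' : Fin n → Ω' → 𝒳 → ℝ)
    (hExp : IsSeqExpX P PX n μ1 μ0 σ1 σ0 F X W Y e)
    (hExp' : IsSeqExpX P' PX n μ1 μ0 σ1 σ0 F' X' W' Y' e')
    -- the second experiment uses the generalized Neyman allocation
    (hstar : ∀ i ω x, e' i ω x = σ1 x / (σ1 x + σ0 x)) :
    ∫ ω, (tauHat2X n μ1 μ0 X W Y e ω - ∫ x, (μ1 x - μ0 x) ∂PX) ^ 2 ∂P -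
      ∫ ω, (tauHat2X n μ1 μ0 X' W' Y' e' ω - ∫ x, (μ1 x - μ0 x) ∂PX) ^ 2 ∂P' =
    (1 / (n : ℝ) ^ 2) *
      (∫ ω, ((∑ i : Fin n, (σ1 (X i ω)) ^ 2 / e i ω (X i ω)) +
          (∑ i : Fin n, (σ0 (X i ω)) ^ 2 / (1 - e i ω (X i ω)))) ∂P -
        n * ∫ x, ((σ1 x) ^ 2 / (σ1 x / (σ1 x + σ0 x)) +
          (σ0 x) ^ 2 / (1 - σ1 x / (σ1 x + σ0 x))) ∂PX) := by
  have hopt : ∀ i, ∫ ω, (σ1 (X' i ω) ^ 2 / e' i ω (X' i ω) +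
      σ0 (X' i ω) ^ 2 / (1 - e' i ω (X' i ω))) ∂P' =
      ∫ x, ((σ1 x) ^ 2 / (σ1 x / (σ1 x + σ0 x)) +
        (σ0 x) ^ 2 / (1 - σ1 x / (σ1 x + σ0 x))) ∂PX := fun i => by
    have h1 := hExp.sigma1_meas
    have h0 := hExp.sigma0_meas
    simp_rw [hstar]
    exact hExp'.integral_comp_X i
      (f := fun x => (σ1 x) ^ 2 / (σ1 x / (σ1 x + σ0 x)) +
        (σ0 x) ^ 2 / (1 - σ1 x / (σ1 x + σ0 x))) (by fun_prop)
  rw [hExp.integral_sq_error hn, hExp'.integral_sq_error hn]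
  simp_rw [hopt, ← Finset.sum_add_distrib]
  rw [integral_finsetSum _ fun i _ => hExp.int_var_e i]
  simp only [Finset.sum_const, Finset.card_univ, Fintype.card_fin, nsmul_eq_mul]
  ring

end CovariateExperiment
end
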